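/- arXiv:2501.11106 — 4 statements merged into one kernel-verified Lean document; each statement's English description precedes it below -/
import Mathlib

section
/- Let Ω ⊆ ℝⁿ be open and f : Ω → ℝⁿ be continuous, approximately differentiable a.e., injective a.e., and satisfy the Lusin condition (N) on a measurable set A ⊆ Ω. Then ∫_A |J_a f(x)| dx = |f(A)|. -/
open MeasureTheory Metric Filter Topology Set
open scoped ENNReal NNReal Topology

noncomputable section

abbrev Em (n : ℕ) : Type := EuclideanSpace ℝ (Fin n)

variable {n : ℕ}

/-- `f` is approximately differentiable at `x` with approximate derivative `L`:
there is a measurable set `S` of density `1` at `x` along which the difference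
quotient tends to zero. -/
def HasApproxDerivAt (f : Em n → Em n) (L : Em n →L[ℝ] Em n) (x : Em n) : Prop :=
  ∃ S : Set (Em n), MeasurableSet S ∧
    Tendsto (fun r : ℝ => volume (S ∩ Metric.ball x r) / volume (Metric.ball x r))
      (𝓝[>] (0 : ℝ)) (𝓝 1) ∧
    Tendsto (fun y => ‖f y - f x - L (y - x)‖ / ‖y - x‖) (𝓝[S \ {x}] x) (𝓝 0)

/-- Regular approximate differentiability. -/
def HasRegularApproxDerivAt (f : Em n → Em n) (L : Em n →L[ℝ] Em n) (x : Em n) : Prop :=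
  HasApproxDerivAt f L x ∧
  ∃ r : ℕ → ℝ, (∀ j, 0 < r j) ∧ Tendsto r atTop (𝓝 (0 : ℝ)) ∧
    Tendsto (fun j => ⨆ h : {h : Em n // ‖h‖ = 1},
        ‖f (x + r j • (h : Em n)) - f x - r j • L (h : Em n)‖ / r j)
      atTop (𝓝 (0 : ℝ))

/-- Lusin condition (N) on a set `A`: images of null subsets of `A` are null. -/
def LusinN (f : Em n → Em n) (A : Set (Em n)) : Prop :=
  ∀ E ⊆ A, volume E = 0 → volume (f '' E) = 0

/-- `f` is injective a.e. on `Ω`: injective off a null set. -/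
def InjectiveAE (f : Em n → Em n) (Ω : Set (Em n)) : Prop :=
  ∃ N ⊆ Ω, volume N = 0 ∧ Set.InjOn f (Ω \ N)

/-- `f` is a homeomorphism of `Ω` onto its image. -/
def IsHomeoOnto (f : Em n → Em n) (Ω : Set (Em n)) : Prop :=
  Topology.IsEmbedding (fun x : Ω => f x)

/-- `Df` is the weak (distributional) derivative of `f` on the open set `Ω`. -/
def HasWeakDerivOn (f : Em n → Em n) (Df : Em n → Em n →L[ℝ] Em n) (Ω : Set (Em n)) : Prop :=
  LocallyIntegrableOn f Ω volume ∧ LocallyIntegrableOn Df Ω volume ∧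
  ∀ φ : Em n → ℝ, ContDiff ℝ (⊤ : ℕ∞) φ → HasCompactSupport φ → tsupport φ ⊆ Ω →
    ∀ v : Em n, ∫ x in Ω, fderiv ℝ φ x v • f x = - ∫ x in Ω, φ x • Df x v

/-- Convergence `f k → g` in `W^{1,p}_loc(Ω)`. -/
def TendstoW1pLocOn (p : ℝ) (f : ℕ → Em n → Em n) (Df : ℕ → Em n → Em n →L[ℝ] Em n)
    (g : Em n → Em n) (Dg : Em n → Em n →L[ℝ] Em n) (Ω : Set (Em n)) : Prop :=
  ∀ K ⊆ Ω, IsCompact K →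
    Tendsto (fun k => ∫⁻ x in K,
        (‖f k x - g x‖₊ : ℝ≥0∞) ^ p + (‖Df k x - Dg x‖₊ : ℝ≥0∞) ^ p) atTop (𝓝 0)

/-- Sign of a real number, as an integer. -/
def rsgn (t : ℝ) : ℤ := if 0 < t then 1 else if t < 0 then -1 else 0

def DensAt (T : Set (Em n)) (x : Em n) : Prop :=
  ∀ ε : ℝ≥0∞, ε ≠ 0 → ∀ᶠ r : ℝ in 𝓝[>] 0, volume (ball x r \ T) ≤ ε * volume (ball x r)

lemma compl_le_of_ratio {α : Type*} [MeasurableSpace α] (μ : Measure α) {T B : Set α}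
    (hT : MeasurableSet T) {ε : ℝ≥0∞} (hB0 : μ B ≠ 0) (hB : μ B ≠ ∞)
    (h : 1 - ε < μ (T ∩ B) / μ B) : μ (B \ T) ≤ ε * μ B := by
  have h1 : (1 - ε) * μ B ≤ μ (T ∩ B) := by
    rw [ENNReal.lt_div_iff_mul_lt (Or.inl hB0) (Or.inl hB)] at h
    exact h.le
  have h2 : μ B ≤ μ (T ∩ B) + ε * μ B := by
    calc μ B = 1 * μ B := (one_mul _).symm
      _ ≤ ((1 - ε) + ε) * μ B := by gcongr; exact le_tsub_add
      _ = (1 - ε) * μ B + ε * μ B := by rw [add_mul]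
      _ ≤ _ := by gcongr
  have h3 : μ (T ∩ B) + μ (B \ T) = μ B := by
    rw [inter_comm]; exact measure_inter_add_diff B hT
  have hfin : μ (T ∩ B) ≠ ∞ := ne_top_of_le_ne_top hB (measure_mono inter_subset_right)
  rw [← h3] at h2
  exact (ENNReal.add_le_add_iff_left hfin).1 (by rw [h3] at h2 ⊢; exact h2)

lemma one_sub_lt {ε : ℝ≥0∞} (hε : ε ≠ 0) : 1 - ε < 1 :=
  ENNReal.sub_lt_self ENNReal.one_ne_top one_ne_zero hε

lemma densAt_of_tendsto {T : Set (Em n)} {x : Em n} (hT : MeasurableSet T)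
    (h : Tendsto (fun r : ℝ => volume (T ∩ Metric.ball x r) / volume (Metric.ball x r))
      (𝓝[>] (0 : ℝ)) (𝓝 1)) : DensAt T x := by
  intro ε hε
  filter_upwards [h.eventually (lt_mem_nhds (one_sub_lt hε)), self_mem_nhdsWithin] with r hr hr0
  exact compl_le_of_ratio volume hT (measure_ball_pos _ _ hr0).ne' measure_ball_lt_top.ne hr

lemma densAt_of_tendsto' {T : Set (Em n)} {x : Em n} (hT : MeasurableSet T)
    (h : Tendsto (fun r : ℝ => volume (T ∩ closedBall x r) / volume (closedBall x r))
      (𝓝[>] (0 : ℝ)) (𝓝 1)) : DensAt T x := by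
  intro ε hε
  filter_upwards [h.eventually (lt_mem_nhds (one_sub_lt hε)), self_mem_nhdsWithin] with r hr hr0
  have hr0' : 0 < r := hr0
  have e : volume (closedBall x r) = volume (ball x r) := by
    rw [Measure.addHaar_closedBall _ _ hr0'.le, Measure.addHaar_ball_of_pos _ _ hr0']
  rw [← e]
  refine le_trans (measure_mono (diff_subset_diff_left ball_subset_closedBall)) ?_
  refine compl_le_of_ratio volume hT ?_ measure_closedBall_lt_top.ne hr
  rw [e]; exact (measure_ball_pos _ _ hr0).ne'

lemma DensAt.inter {S T : Set (Em n)} {x : Em n} (hS : DensAt S x) (hT : DensAt T x) :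
    DensAt (S ∩ T) x := by
  intro ε hε
  have h2 : ε / 2 ≠ 0 := by simp [hε]
  filter_upwards [hS _ h2, hT _ h2] with r h1 h2
  rw [diff_inter]
  calc _ ≤ _ := measure_union_le _ _
    _ ≤ ε / 2 * volume (ball x r) + ε / 2 * volume (ball x r) := add_le_add h1 h2
    _ = _ := by rw [← add_mul, ENNReal.add_halves]

lemma DensAt.nonempty {T : Set (Em n)} {x : Em n} (hT : DensAt T x) {v : Em n} {c : ℝ}
    (hc : 0 < c) (hv : ‖v‖ + c ≤ 1) :
    ∀ᶠ r : ℝ in 𝓝[>] 0, (ball (x + r • v) (c * r) ∩ T).Nonempty := by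
  have hp : (0 : ℝ≥0∞) < ENNReal.ofReal (c ^ Module.finrank ℝ (Em n)) :=
    ENNReal.ofReal_pos.2 (pow_pos hc _)
  have hε : ENNReal.ofReal (c ^ Module.finrank ℝ (Em n)) / 2 ≠ 0 := by
    simp [pow_pos hc]
  filter_upwards [hT _ hε, self_mem_nhdsWithin] with r hr hr0
  have hr0 : 0 < r := hr0
  by_contra hne
  rw [Set.not_nonempty_iff_eq_empty] at hne
  have hsub : ball (x + r • v) (c * r) ⊆ ball x r \ T := by
    intro y hy
    refine ⟨?_, fun hyT => ?_⟩
    · have := dist_triangle y (x + r • v) x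
      have h1 : dist (x + r • v) x = r * ‖v‖ := by
        simp [dist_eq_norm, norm_smul, abs_of_pos hr0]
      rw [mem_ball] at hy ⊢
      nlinarith
    · have : y ∈ ball (x + r • v) (c * r) ∩ T := ⟨hy, hyT⟩
      rw [hne] at this; exact this
  have h2 := (measure_mono hsub).trans hr
  rw [Measure.addHaar_ball_mul_of_pos _ _ hc, Measure.addHaar_ball_center volume x] at h2
  have hb : volume (ball (0 : Em n) r) ≠ 0 := (measure_ball_pos _ _ hr0).ne'
  rw [ENNReal.mul_le_mul_iff_left hb measure_ball_lt_top.ne] at h2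
  exact absurd h2 (not_le.2 (ENNReal.half_lt_self hp.ne' ENNReal.ofReal_ne_top))

lemma DensAt.uniqueDiff {T : Set (Em n)} {x : Em n} (hT : DensAt T x) :
    UniqueDiffWithinAt ℝ T x := by
  have key : ball (0 : Em n) 1 ⊆ tangentConeAt ℝ T x := by
    intro v hv
    rw [mem_ball_zero_iff] at hv
    rw [tangentConeAt_eq_biInter_closure]
    simp only [mem_iInter]
    intro U hU
    rw [Metric.mem_closure_iff]
    intro ε hε
    obtain ⟨ρ, hρ, hρU⟩ := Metric.mem_nhds_iff.1 hU
    have hc : 0 < min ε (1 - ‖v‖) := lt_min hε (by linarith)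
    have hc2 : ‖v‖ + min ε (1 - ‖v‖) ≤ 1 := by linarith [min_le_right ε (1 - ‖v‖)]
    have h2 : ∀ᶠ r : ℝ in 𝓝[>] 0, r < ρ := nhdsWithin_le_nhds (Iio_mem_nhds hρ)
    obtain ⟨r, ⟨⟨y, hy, hyT⟩, hrρ⟩, hr0⟩ := (((hT.nonempty hc hc2).and h2).and self_mem_nhdsWithin).exists
    have hr0 : 0 < r := hr0
    have hyn : ‖y - x - r • v‖ < min ε (1 - ‖v‖) * r := by
      rw [mem_ball, dist_eq_norm] at hy
      rwa [sub_sub]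
    refine ⟨r⁻¹ • (y - x), Set.smul_mem_smul (mem_univ _) ⟨hρU ?_, ?_⟩, ?_⟩
    · rw [mem_ball_zero_iff]
      have : ‖y - x‖ ≤ ‖y - x - r • v‖ + ‖r • v‖ := norm_le_norm_sub_add _ _
      rw [norm_smul, Real.norm_of_nonneg hr0.le] at this
      nlinarith
    · simpa using hyT
    · rw [dist_comm, dist_eq_norm]
      have : r⁻¹ • (y - x) - v = r⁻¹ • (y - x - r • v) := by
        rw [smul_sub _ _ (r • v), smul_smul, inv_mul_cancel₀ hr0.ne', one_smul]
      rw [this, norm_smul, norm_inv, Real.norm_of_nonneg hr0.le, inv_mul_lt_iff₀ hr0]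
      nlinarith [min_le_left ε (1 - ‖v‖)]
  refine ⟨?_, mem_closure_of_nonempty_tangentConeAt (𝕜 := ℝ) ⟨0, key (by simp)⟩⟩
  have : Submodule.span ℝ (tangentConeAt ℝ T x) = ⊤ := by
    apply Submodule.eq_top_of_nonempty_interior'
    refine ⟨0, mem_interior_iff_mem_nhds.2 ?_⟩
    exact Filter.mem_of_superset (ball_mem_nhds 0 one_pos) (key.trans Submodule.subset_span)
  rw [this]; exact dense_univ

lemma HasApproxDerivAt.exists_within {f : Em n → Em n} {L : Em n →L[ℝ] Em n} {x : Em n}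
    (h : HasApproxDerivAt f L x) : ∃ S, DensAt S x ∧ HasFDerivWithinAt f L S x := by
  obtain ⟨S, hS, hd, ht⟩ := h
  refine ⟨S, densAt_of_tendsto hS hd, ?_⟩
  rw [← hasFDerivWithinAt_diff_singleton x, hasFDerivWithinAt_iff_tendsto]
  refine ht.congr fun y => ?_
  rw [div_eq_inv_mul]

/-- The Lipschitz pieces. -/
def Epc (f : Em n → Em n) (k : ℕ) : Set (Em n) :=
  {x | ∃ S : Set (Em n), ∀ r : ℝ, 0 < r → r < 1 / ((k : ℝ) + 1) →
    volume (ball x r \ S) ≤ ENNReal.ofReal ((1/2) ^ Module.finrank ℝ (Em n)) / 3 * volume (ball x r) ∧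
    ∀ y ∈ S, y ∈ ball x r → ‖f y - f x‖ ≤ k * ‖y - x‖}

lemma HasApproxDerivAt.mem_Epc {f : Em n → Em n} {L : Em n →L[ℝ] Em n} {x : Em n}
    (h : HasApproxDerivAt f L x) : ∃ k, x ∈ Epc f k := by
  obtain ⟨S, hS, hd⟩ := h.exists_within
  have hε : ENNReal.ofReal ((1/2 : ℝ) ^ Module.finrank ℝ (Em n)) / 3 ≠ 0 := by
    simp
  obtain ⟨C, hC⟩ := hd.isBigO_sub.bound
  rw [eventually_nhdsWithin_iff, Metric.eventually_nhds_iff_ball] at hC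
  obtain ⟨ρ, hρ, hC⟩ := hC
  obtain ⟨δ, hδ, hδ'⟩ := mem_nhdsGT_iff_exists_Ioo_subset.1 (hS _ hε)
  have hδ : 0 < δ := hδ
  obtain ⟨k1, hk1⟩ := exists_nat_one_div_lt (lt_min hρ hδ)
  obtain ⟨k2, hk2⟩ := exists_nat_ge C
  refine ⟨max k1 k2, S, fun r hr0 hr => ?_⟩
  have hle : (1 : ℝ) / (((max k1 k2 : ℕ) : ℝ) + 1) ≤ 1 / ((k1 : ℝ) + 1) := by
    gcongr; exact le_max_left _ _
  have hr1 : r < min ρ δ := by linarith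
  refine ⟨hδ' ⟨hr0, hr1.trans_le (min_le_right _ _)⟩, fun y hy hyr => ?_⟩
  refine (hC y (ball_subset_ball (hr1.le.trans (min_le_left _ _)) hyr) hy).trans ?_
  gcongr
  exact hk2.trans (by exact_mod_cast le_max_right _ _)

lemma Epc_lip {f : Em n → Em n} {k : ℕ} (u : Em n) :
    LipschitzOnWith (3 * k : ℝ≥0) f (Epc f k ∩ ball u (1 / (4 * ((k : ℝ) + 1)))) := by
  refine LipschitzOnWith.of_dist_le_mul ?_
  rintro x ⟨⟨S, hS⟩, hxu⟩ x' ⟨⟨S', hS'⟩, hxu'⟩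
  rcases eq_or_ne x x' with rfl | hne
  · simp
  set d := dist x x' with hd
  have hd0 : 0 < d := dist_pos.2 hne
  have hk : (0 : ℝ) < (k : ℝ) + 1 := by positivity
  have hdlt : 2 * d < 1 / ((k : ℝ) + 1) := by
    have := dist_triangle_right x x' u
    rw [mem_ball] at hxu hxu'
    have e : 1 / (4 * ((k : ℝ) + 1)) = (1 / ((k : ℝ) + 1)) / 4 := by field_simp
    rw [e] at hxu hxu'
    linarith
  obtain ⟨h1, h2⟩ := hS (2 * d) (by linarith) hdlt
  obtain ⟨h1', h2'⟩ := hS' (2 * d) (by linarith) hdlt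
  have hb : volume (ball x d) = ENNReal.ofReal ((1/2) ^ Module.finrank ℝ (Em n)) *
      volume (ball (0 : Em n) (2 * d)) := by
    rw [← Measure.addHaar_ball_mul_of_pos volume x (by norm_num : (0 : ℝ) < 1/2)]
    congr 2; ring
  have hbpos : volume (ball x d) ≠ 0 := (measure_ball_pos _ _ hd0).ne'
  have hbfin : volume (ball x d) ≠ ∞ := measure_ball_lt_top.ne
  have e3 : ∀ z : Em n, ENNReal.ofReal ((1/2) ^ Module.finrank ℝ (Em n)) / 3 *
      volume (ball z (2 * d)) = volume (ball x d) / 3 := by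
    intro z
    rw [Measure.addHaar_ball_center, hb, ENNReal.mul_div_right_comm]
  rw [e3] at h1 h1'
  obtain ⟨z, hz, hzS, hzS'⟩ : ∃ z ∈ ball x d, z ∈ S ∧ z ∈ S' := by
    by_contra! hcon
    have hsub : ball x d ⊆ (ball x (2 * d) \ S) ∪ (ball x' (2 * d) \ S') := by
      intro z hz
      by_cases hzS : z ∈ S
      · refine Or.inr ⟨?_, hcon z hz hzS⟩
        rw [mem_ball] at hz ⊢
        linarith [dist_triangle z x x']
      · refine Or.inl ⟨?_, hzS⟩
        rw [mem_ball] at hz ⊢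
        linarith
    have := ((measure_mono hsub).trans (measure_union_le _ _)).trans (add_le_add h1 h1')
    have h5 := ENNReal.toReal_mono (by finiteness) this
    rw [ENNReal.toReal_add (by finiteness) (by finiteness), ENNReal.toReal_div] at h5
    have h6 := ENNReal.toReal_pos hbpos hbfin
    norm_num at h5
    linarith
  rw [mem_ball] at hz
  have hz' : dist z x' < 2 * d := by linarith [dist_triangle z x x']
  have g1 := h2 z hzS (by rw [mem_ball]; linarith)
  have g2 := h2' z hzS' hz'
  rw [← dist_eq_norm, ← dist_eq_norm] at g1 g2
  have hk0 : (0 : ℝ) ≤ k := by positivity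
  have := dist_triangle_left (f x) (f x') (f z)
  push_cast
  nlinarith

lemma lip_closure {f : Em n → Em n} {C : ℝ≥0} {s Ω : Set (Em n)} (hΩ : IsOpen Ω)
    (hf : ContinuousOn f Ω) (h : LipschitzOnWith C f s) :
    LipschitzOnWith C f (closure s ∩ Ω) := by
  refine LipschitzOnWith.of_dist_le_mul ?_
  rintro x ⟨hx, hxΩ⟩ y ⟨hy, hyΩ⟩
  have hcx : ContinuousAt f x := hf.continuousAt (hΩ.mem_nhds hxΩ)
  have hcy : ContinuousAt f y := hf.continuousAt (hΩ.mem_nhds hyΩ)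
  have hxy : (x, y) ∈ closure (s ×ˢ s) := by rw [closure_prod_eq]; exact ⟨hx, hy⟩
  have c1 : ContinuousAt (fun p : Em n × Em n => dist (f p.1) (f p.2)) (x, y) :=
    (ContinuousAt.comp (f := Prod.fst) hcx continuousAt_fst).dist
      (ContinuousAt.comp (f := Prod.snd) hcy continuousAt_snd)
  have c2 : ContinuousAt (fun p : Em n × Em n => (C : ℝ) * dist p.1 p.2) (x, y) := by fun_prop
  exact ContinuousWithinAt.closure_le hxy c1.continuousWithinAt c2.continuousWithinAt
    (fun p hp => h.dist_le_mul _ hp.1 _ hp.2)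

lemma ae_hasFDerivWithinAt {f : Em n → Em n} {Df : Em n → Em n →L[ℝ] Em n} {C : ℝ≥0}
    {H Ω : Set (Em n)} (hHΩ : H ⊆ Ω) (hΩ : MeasurableSet Ω)
    (hDf : ∀ᵐ x ∂(volume.restrict Ω), HasApproxDerivAt f (Df x) x)
    (hH : MeasurableSet H) (h : LipschitzOnWith C f H) :
    ∀ᵐ x, x ∈ H → HasFDerivWithinAt f (Df x) H x := by
  have h1 := h.ae_differentiableWithinAt_of_mem (μ := volume)
  have h2 := (ae_restrict_iff' hH).1 (Besicovitch.ae_tendsto_measure_inter_div volume H)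
  filter_upwards [h1, h2, (ae_restrict_iff' hΩ).1 hDf] with x h1 h2 h3 hx
  obtain ⟨S, hS, hd⟩ := (h3 (hHΩ hx)).exists_within
  have hu := (hS.inter (densAt_of_tendsto' hH (h2 hx))).uniqueDiff
  have hd' := (h1 hx).hasFDerivWithinAt
  have e := hu.eq (hd.mono inter_subset_left) (hd'.mono inter_subset_right)
  rw [e]; exact hd'

theorem stmt6 {n : ℕ} (Ω : Set (Em n)) (hΩ : IsOpen Ω)
    (f : Em n → Em n) (hf : ContinuousOn f Ω)
    (Df : Em n → Em n →L[ℝ] Em n)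
    (hDf : ∀ᵐ x ∂(volume.restrict Ω), HasApproxDerivAt f (Df x) x)
    (hinj : InjectiveAE f Ω)
    (A : Set (Em n)) (hA : A ⊆ Ω) (hAm : MeasurableSet A)
    (hNA : LusinN f A) :
    ∫⁻ x in A, ENNReal.ofReal |(Df x).det| = volume (f '' A) := by
  obtain ⟨N, hNΩ, hN0, hinj⟩ := hinj
  set H : ℕ × ℕ → Set (Em n) := fun p =>
    closure (Epc f p.1 ∩ ball (TopologicalSpace.denseSeq (Em n) p.2) (1 / (4 * ((p.1 : ℝ) + 1)))) ∩ A
    with hHdef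
  have hHm : ∀ p, MeasurableSet (H p) := fun p => isClosed_closure.measurableSet.inter hAm
  have hHd : ∀ p, ∀ᵐ x, x ∈ H p → HasFDerivWithinAt f (Df x) (H p) x := fun p =>
    ae_hasFDerivWithinAt (C := 3 * p.1) (inter_subset_right.trans hA) hΩ.measurableSet hDf (hHm p)
      ((lip_closure hΩ hf (Epc_lip _)).mono (inter_subset_inter_right _ hA))
  have hcov : ∀ᵐ x, x ∈ A → ∃ p, x ∈ H p := by
    filter_upwards [(ae_restrict_iff' hΩ.measurableSet).1 hDf] with x hx hxA
    obtain ⟨k, hk⟩ := (hx (hA hxA)).mem_Epc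
    obtain ⟨j, hj⟩ := (TopologicalSpace.denseRange_denseSeq (Em n)).exists_dist_lt x
      (by positivity : (0 : ℝ) < 1 / (4 * ((k : ℝ) + 1)))
    exact ⟨(k, j), subset_closure ⟨hk, hj⟩, hxA⟩
  have hN : ∀ᵐ x, x ∉ N := measure_eq_zero_iff_ae_notMem.1 hN0
  have hall : ∀ᵐ x, (∀ p, x ∈ H p → HasFDerivWithinAt f (Df x) (H p) x) ∧
      (x ∈ A → ∃ p, x ∈ H p) ∧ x ∉ N := by
    filter_upwards [ae_all_iff.2 hHd, hcov, hN] with x h1 h2 h3 using ⟨h1, h2, h3⟩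
  obtain ⟨M, hMsub, hMm, hM0⟩ := exists_measurable_superset_of_null (ae_iff.1 hall)
  have hgood : ∀ x ∉ M, (∀ p, x ∈ H p → HasFDerivWithinAt f (Df x) (H p) x) ∧
      (x ∈ A → ∃ p, x ∈ H p) ∧ x ∉ N := fun x hx => by
    by_contra hc; exact hx (hMsub hc)
  let e := Denumerable.eqv (ℕ × ℕ)
  let G0 : ℕ → Set (Em n) := fun i => H (e.symm i) \ M
  let G : ℕ → Set (Em n) := disjointed G0
  have hG0m : ∀ i, MeasurableSet (G0 i) := fun i => (hHm _).diff hMm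
  have hGm : ∀ i, MeasurableSet (G i) := fun i => MeasurableSet.disjointed hG0m i
  have hGsub : ∀ i, G i ⊆ G0 i := fun i => disjointed_subset G0 i
  have hGU : ⋃ i, G i = A \ M := by
    rw [show ⋃ i, G i = ⋃ i, G0 i from iUnion_disjointed]
    ext x
    simp only [mem_iUnion]
    constructor
    · rintro ⟨i, hi, hM⟩; exact ⟨hi.2, hM⟩
    · rintro ⟨hxA, hM⟩
      obtain ⟨p, hp⟩ := (hgood x hM).2.1 hxA
      exact ⟨e p, by simpa [G0] using ⟨hp, hM⟩⟩
  have hGd : Pairwise (Function.onFun Disjoint G) := disjoint_disjointed G0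
  have hsubN : A \ M ⊆ Ω \ N := fun x hx => ⟨hA hx.1, (hgood x hx.2).2.2⟩
  have hinjAM : InjOn f (A \ M) := InjOn.mono hsubN hinj
  have hGA : ∀ i, G i ⊆ A \ M := fun i => hGU ▸ subset_iUnion G i
  have hGder : ∀ i, ∀ x ∈ G i, HasFDerivWithinAt f (Df x) (G i) x := fun i x hx =>
    ((hgood x (hGsub i hx).2).1 _ (hGsub i hx).1).mono ((hGsub i).trans diff_subset)
  have hcv : ∀ i, ∫⁻ x in G i, ENNReal.ofReal |(Df x).det| = volume (f '' G i) := fun i =>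
    lintegral_abs_det_fderiv_eq_addHaar_image volume (hGm i) (hGder i) (hinjAM.mono (hGA i))
  have hAae : (A \ M : Set (Em n)) =ᵐ[volume] A := diff_null_ae_eq_self hM0
  have himg : volume (f '' A) = volume (f '' (A \ M)) := by
    refine le_antisymm ?_ (measure_mono (image_mono diff_subset))
    have hz : volume (f '' (A ∩ M)) = 0 :=
      hNA _ inter_subset_left (measure_mono_null inter_subset_right hM0)
    calc volume (f '' A) = volume (f '' (A \ M) ∪ f '' (A ∩ M)) := by
          rw [← image_union, diff_union_inter]
      _ ≤ _ := measure_union_le _ _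
      _ = _ := by rw [hz, add_zero]
  rw [himg, ← Measure.restrict_congr_set hAae, ← hGU, lintegral_iUnion hGm hGd, image_iUnion,
    measure_iUnion]
  · exact tsum_congr hcv
  · intro i j hij
    exact (hGd hij).image hinjAM (hGA i) (hGA j)
  · exact fun i => measurable_image_of_fderivWithin (hGm i) (hGder i) (hinjAM.mono (hGA i))
end
end

section
/- Let Ω ⊆ ℝⁿ be a bounded domain and f_k : Ω → ℝⁿ continuous, injective a.e., and approximately differentiable a.e. Suppose f : Ω → ℝⁿ satisfies the Lusin condition (N), is approximately differentiable a.e., and J_a f is locally integrable. If D_a f_k → D_a f in Lebesgue measure on Ω and |f_k(E)| → |f(E)| for every Borel set E compactly contained in Ω, then J_a f_k → J_a f in L¹_loc(Ω). -/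
open MeasureTheory Metric Filter Topology Set
open scoped ENNReal NNReal Topology

noncomputable section

variable {n : ℕ}

open scoped Pointwise

/-- Intersecting a set of outer density one with a measurable set of density one. -/
lemma density_inter_aux {S A : Set (Em n)} {x : Em n} (hS : MeasurableSet S)
    (hSd : Tendsto (fun r : ℝ => volume (S ∩ Metric.ball x r) / volume (Metric.ball x r))
      (𝓝[>] (0 : ℝ)) (𝓝 1))
    (hA : Tendsto (fun r => volume (A ∩ closedBall x r) / volume (closedBall x r))
      (𝓝[>] (0 : ℝ)) (𝓝 1)) :
    Tendsto (fun r => volume ((S ∩ A) ∩ closedBall x r) / volume (closedBall x r))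
      (𝓝[>] (0 : ℝ)) (𝓝 1) := by
  have h1 : Tendsto (fun r : ℝ => volume (A ∩ closedBall x r) / volume (closedBall x r) -
      (1 - volume (S ∩ Metric.ball x r) / volume (Metric.ball x r)))
      (𝓝[>] (0 : ℝ)) (𝓝 (1 - (1 - 1))) :=
    ENNReal.Tendsto.sub hA (ENNReal.Tendsto.sub tendsto_const_nhds hSd (by simp)) (by simp)
  simp only [tsub_self, tsub_zero] at h1
  refine tendsto_of_tendsto_of_tendsto_of_le_of_le' h1 tendsto_const_nhds ?_ ?_
  · filter_upwards [self_mem_nhdsWithin] with r hr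
    have hr : 0 < r := hr
    have e : volume (Metric.ball x r) = volume (closedBall x r) := by
      rw [Measure.addHaar_ball_of_pos volume x hr, Measure.addHaar_closedBall volume x hr.le]
    have hb0 : volume (closedBall x r) ≠ 0 := (measure_closedBall_pos volume x hr).ne'
    have hbt : volume (closedBall x r) ≠ ∞ := measure_closedBall_lt_top.ne
    rw [e]
    set b := volume (closedBall x r)
    rw [tsub_le_iff_right]
    have h2 : volume (A ∩ closedBall x r) ≤
        volume ((S ∩ A) ∩ closedBall x r) + volume (closedBall x r \ S) := by
      refine (measure_mono ?_).trans (measure_union_le _ _)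
      intro y hy
      by_cases hyS : y ∈ S
      · exact Or.inl ⟨⟨hyS, hy.1⟩, hy.2⟩
      · exact Or.inr ⟨hy.2, hyS⟩
    have h3 : volume (closedBall x r \ S) ≤ b - volume (S ∩ Metric.ball x r) := by
      apply ENNReal.le_sub_of_add_le_right
      · exact ((measure_mono (inter_subset_right)).trans_lt measure_ball_lt_top).ne
      · rw [add_comm]
        calc volume (S ∩ Metric.ball x r) + volume (closedBall x r \ S)
            ≤ volume (closedBall x r ∩ S) + volume (closedBall x r \ S) := by
              refine add_le_add (measure_mono ?_) le_rfl
              intro y hy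
              exact ⟨ball_subset_closedBall hy.2, hy.1⟩
          _ = b := measure_inter_add_sdiff _ hS
    have h4 : 1 - volume (S ∩ Metric.ball x r) / b = (b - volume (S ∩ Metric.ball x r)) / b := by
      rw [ENNReal.sub_div (fun _ _ => hb0), ENNReal.div_self hb0 hbt]
    rw [h4, ← ENNReal.add_div]
    gcongr
    exact h2.trans (by gcongr)
  · filter_upwards with r
    refine (ENNReal.div_le_div_right (measure_mono inter_subset_right) _).trans ENNReal.div_self_le_one

lemma hasFDerivWithinAt_of_approx {h : Em n → Em n} {L : Em n →L[ℝ] Em n} {x : Em n}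
    {S : Set (Em n)}
    (hS : Tendsto (fun y => ‖h y - h x - L (y - x)‖ / ‖y - x‖) (𝓝[S \ {x}] x) (𝓝 0)) :
    HasFDerivWithinAt h L S x := by
  rw [← hasFDerivWithinAt_sdiff_singleton x, hasFDerivWithinAt_iff_tendsto]
  refine hS.congr fun y => ?_
  rw [div_eq_inv_mul]

/-- Comparison at a density point. -/
lemma approx_compare {h H : Em n → Em n} {L : Em n →L[ℝ] Em n} {x : Em n} {A : Set (Em n)}
    (hh : HasApproxDerivAt h L x)
    (hA : Tendsto (fun r => volume (A ∩ closedBall x r) / volume (closedBall x r))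
      (𝓝[>] (0 : ℝ)) (𝓝 1))
    (hHA : EqOn h H A) (hH : DifferentiableAt ℝ H x) :
    h x = H x ∧ L = fderiv ℝ H x := by
  obtain ⟨S, hSm, hSd, hSt⟩ := hh
  have hd := density_inter_aux hSm hSd hA
  have h1 : HasFDerivWithinAt h L (S ∩ A) x :=
    (hasFDerivWithinAt_of_approx hSt).mono inter_subset_left
  have h2 : HasFDerivWithinAt H (fderiv ℝ H x) (S ∩ A) x := hH.hasFDerivAt.hasFDerivWithinAt
  have key : ∀ (z : Em n) (ε : ℝ), 0 < ε → ∀ ρ > 0, ∃ r : ℝ, 0 < r ∧ ∃ a ∈ closedBall z ε,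
      x + r • a ∈ S ∩ A ∧ x + r • a ∈ ball x ρ := by
    intro z ε εpos ρ ρpos
    have B₁ : ∀ᶠ r in 𝓝[>] (0 : ℝ), ((S ∩ A) ∩ ({x} + r • closedBall z ε)).Nonempty :=
      Measure.eventually_nonempty_inter_smul_of_density_one volume _ x hd _
        measurableSet_closedBall (measure_closedBall_pos volume z εpos).ne'
    have B₂ : ∀ᶠ r in 𝓝[>] (0 : ℝ), {x} + r • closedBall z ε ⊆ ball x ρ := by
      apply nhdsWithin_le_nhds
      exact eventually_singleton_add_smul_subset isBounded_closedBall (ball_mem_nhds x ρpos)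
    obtain ⟨r, ⟨y, ⟨ys, hy⟩⟩, rρ, rpos⟩ := (B₁.and (B₂.and self_mem_nhdsWithin)).exists
    obtain ⟨a, az, ya⟩ : ∃ a, a ∈ closedBall z ε ∧ y = x + r • a := by
      simp only [mem_smul_set, image_add_left, mem_preimage, singleton_add] at hy
      rcases hy with ⟨a, az, ha⟩
      exact ⟨a, az, by simp only [ha, add_neg_cancel_left]⟩
    exact ⟨r, rpos, a, az, ya ▸ ys, ya ▸ rρ hy⟩
  have hne : (𝓝[S ∩ A] x).NeBot := by
    rw [← mem_closure_iff_nhdsWithin_neBot, Metric.mem_closure_iff]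
    intro ρ hρ
    obtain ⟨r, -, a, -, h3, h4⟩ := key 0 1 one_pos ρ hρ
    exact ⟨_, h3, by rw [dist_comm]; exact h4⟩
  have hx : h x = H x := by
    refine tendsto_nhds_unique h1.continuousWithinAt (Tendsto.congr' ?_ h2.continuousWithinAt)
    filter_upwards [self_mem_nhdsWithin] with y hy
    exact (hHA hy.2).symm
  refine ⟨hx, ?_⟩
  set M := fderiv ℝ H x
  have h3 : HasFDerivWithinAt (fun _ => (0 : Em n)) (L - M) (S ∩ A) x := by
    refine (h1.sub h2).congr ?_ ?_
    · intro y hy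
      simp [hHA hy.2]
    · simp [hx]
  rw [← sub_eq_zero]
  ext1 z
  change (L - M) z = 0
  rw [← norm_le_zero_iff]
  have H : ∀ ε : ℝ, 0 < ε → ‖(L - M) z‖ ≤ ε * (‖z‖ + ε) + ‖L - M‖ * ε := by
    intro ε εpos
    obtain ⟨ρ, ρpos, hρ⟩ := mem_nhdsWithin_iff.1 (h3.isLittleO.def εpos)
    obtain ⟨r, rpos, a, az, ys, yb⟩ := key z ε εpos ρ ρpos
    have h5 := hρ ⟨yb, ys⟩
    have h5 : ‖(L - M) (r • a)‖ ≤ ε * ‖r • a‖ := by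
      have h5 : ‖(0 : Em n) - 0 - (L - M) (x + r • a - x)‖ ≤ ε * ‖x + r • a - x‖ := h5
      rwa [sub_zero, zero_sub, norm_neg, add_sub_cancel_left] at h5
    rw [map_smul, norm_smul, norm_smul, Real.norm_eq_abs, abs_of_pos rpos] at h5
    have h6 : ‖(L - M) a‖ ≤ ε * ‖a‖ := by
      have : r * ‖(L - M) a‖ ≤ r * (ε * ‖a‖) := by linarith
      exact le_of_mul_le_mul_left this rpos
    rw [mem_closedBall, dist_eq_norm] at az
    have norm_a : ‖a‖ ≤ ‖z‖ + ε := by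
      have := norm_le_norm_add_norm_sub' a z
      linarith
    have h7 : ‖(L - M) z‖ ≤ ‖(L - M) a‖ + ‖(L - M) (a - z)‖ := by
      have : (L - M) z = (L - M) a - (L - M) (a - z) := by rw [← map_sub]; simp
      rw [this]; exact norm_sub_le _ _
    have h8 := (L - M).le_opNorm (a - z)
    have h9 : ‖L - M‖ * ‖a - z‖ ≤ ‖L - M‖ * ε := by gcongr
    have h10 : ε * ‖a‖ ≤ ε * (‖z‖ + ε) := by gcongr
    linarith
  have : Tendsto (fun ε : ℝ => ε * (‖z‖ + ε) + ‖L - M‖ * ε) (𝓝[>] 0)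
      (𝓝 (0 * (‖z‖ + 0) + ‖L - M‖ * 0)) :=
    Tendsto.mono_left (Continuous.tendsto (by fun_prop) 0) nhdsWithin_le_nhds
  simp only [add_zero, mul_zero, zero_mul] at this
  refine le_of_tendsto_of_tendsto tendsto_const_nhds this ?_
  filter_upwards [self_mem_nhdsWithin] with ε hε using H ε hε

/-- Uniform quantitative version of approximate Lipschitz behaviour. -/
def GoodPt (h : Em n → Em n) (j : ℕ) (x : Em n) : Prop :=
  ∃ S : Set (Em n), MeasurableSet S ∧ (∀ y ∈ S, ‖h y - h x‖ ≤ j * ‖y - x‖) ∧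
    ∀ r : ℝ, 0 < r → r < 1 / ((j : ℝ) + 1) →
      2 * 2 ^ n * volume.real (ball x r \ S) < volume.real (ball x r)

lemma exists_goodPt {h : Em n → Em n} {L : Em n →L[ℝ] Em n} {x : Em n}
    (hh : HasApproxDerivAt h L x) : ∃ j, GoodPt h j x := by
  obtain ⟨S, hSm, hSd, hSt⟩ := hh
  have h1 := hasFDerivWithinAt_of_approx hSt
  obtain ⟨ρ, ρpos, hρ⟩ := mem_nhdsWithin_iff.1 (h1.isLittleO.def one_pos)
  have hc : (0 : ℝ) < (2 * 2 ^ n)⁻¹ := by positivity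
  have h2 : Tendsto (fun r : ℝ => volume.real (S ∩ ball x r) / volume.real (ball x r))
      (𝓝[>] (0 : ℝ)) (𝓝 1) := by
    have := (ENNReal.tendsto_toReal (by simp : (1 : ℝ≥0∞) ≠ ∞)).comp hSd
    simpa [Function.comp_def, Measure.real, ENNReal.toReal_div] using this
  have h3 : ∀ᶠ r in 𝓝[>] (0 : ℝ), 1 - (2 * 2 ^ n : ℝ)⁻¹ <
      volume.real (S ∩ ball x r) / volume.real (ball x r) :=
    h2.eventually (lt_mem_nhds (by linarith))
  obtain ⟨δ, δpos, hδ⟩ := mem_nhdsGT_iff_exists_Ioo_subset.1 h3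
  obtain ⟨j, hj⟩ := exists_nat_gt (max (‖L‖ + 1) (max (1 / ρ) (1 / δ)))
  have δpos : 0 < δ := δpos
  have hj1 : ‖L‖ + 1 < j := (le_max_left _ _).trans_lt hj
  have hj2 : 1 / ρ < j := ((le_max_left _ _).trans (le_max_right _ _)).trans_lt hj
  have hj3 : 1 / δ < j := ((le_max_right _ _).trans (le_max_right _ _)).trans_lt hj
  have hjρ : 1 / ((j : ℝ) + 1) < ρ := by
    rw [div_lt_iff₀ (by positivity)]
    rw [div_lt_iff₀ ρpos] at hj2
    nlinarith
  have hjδ : 1 / ((j : ℝ) + 1) < δ := by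
    rw [div_lt_iff₀ (by positivity)]
    rw [div_lt_iff₀ δpos] at hj3
    nlinarith
  refine ⟨j, S ∩ ball x ρ, hSm.inter measurableSet_ball, ?_, ?_⟩
  · rintro y ⟨hyS, hyb⟩
    have h4 : ‖h y - h x - L (y - x)‖ ≤ 1 * ‖y - x‖ := hρ ⟨hyb, hyS⟩
    have h5 := L.le_opNorm (y - x)
    have h6 := norm_le_norm_add_norm_sub' (h y - h x) (L (y - x))
    nlinarith [norm_nonneg (y - x)]
  · intro r hr hrj
    have h4 := hδ (show r ∈ Ioo 0 δ from ⟨hr, hrj.trans hjδ⟩)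
    have h4 : 1 - (2 * 2 ^ n : ℝ)⁻¹ < volume.real (S ∩ ball x r) / volume.real (ball x r) := h4
    have hb : 0 < volume.real (ball x r) := by
      apply ENNReal.toReal_pos (measure_ball_pos volume x hr).ne' measure_ball_lt_top.ne
    have h5 : ball x r \ (S ∩ ball x ρ) = ball x r \ S := by
      ext y
      simp only [Set.mem_sdiff, Set.mem_inter_iff, not_and]
      constructor
      · rintro ⟨h6, h7⟩
        exact ⟨h6, fun h8 => h7 h8 (ball_subset_ball (hrj.trans hjρ).le h6)⟩
      · rintro ⟨h6, h7⟩
        exact ⟨h6, fun h8 => absurd h8 h7⟩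
    rw [h5]
    have h6 := measureReal_inter_add_sdiff (μ := volume) (s := ball x r) hSm
      (measure_ball_lt_top.ne)
    rw [inter_comm] at h6
    rw [lt_div_iff₀ hb] at h4
    have h7 : volume.real (ball x r \ S) < (2 * 2 ^ n : ℝ)⁻¹ * volume.real (ball x r) := by
      linarith
    have h8 := mul_lt_mul_of_pos_left h7 (show (0 : ℝ) < 2 * 2 ^ n by positivity)
    rwa [← mul_assoc, mul_inv_cancel₀ (by positivity), one_mul] at h8

lemma GoodPt.lip {h : Em n → Em n} {j : ℕ} {x x' : Em n} (hx : GoodPt h j x)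
    (hx' : GoodPt h j x') (hd : dist x x' < 1 / (2 * ((j : ℝ) + 1))) :
    dist (h x) (h x') ≤ 3 * j * dist x x' := by
  rcases eq_or_ne x x' with rfl | hne
  · simp
  obtain ⟨S, hSm, hS1, hS2⟩ := hx
  obtain ⟨S', hSm', hS1', hS2'⟩ := hx'
  set r := dist x x' with hr
  have rpos : 0 < r := dist_pos.2 hne
  have hr2 : 2 * r < 1 / ((j : ℝ) + 1) := by
    have : 1 / (2 * ((j : ℝ) + 1)) = (1 / ((j : ℝ) + 1)) / 2 := by field_simp
    linarith
  have a1 := hS2 (2 * r) (by linarith) hr2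
  have a2 := hS2' (2 * r) (by linarith) hr2
  have vol2 : ∀ y : Em n, volume.real (ball y (2 * r)) = 2 ^ n * volume.real (ball x r) := by
    intro y
    rw [Measure.real, Measure.real, Measure.addHaar_ball_mul_of_pos volume y two_pos,
      Measure.addHaar_ball_center, ENNReal.toReal_mul, ENNReal.toReal_ofReal (by positivity),
      ← Measure.addHaar_ball_center volume x r]
    simp
  rw [vol2] at a1 a2
  have p2 : (0 : ℝ) < 2 ^ n := by positivity
  have b1 : 2 * volume.real (ball x (2 * r) \ S) < volume.real (ball x r) := by
    refine lt_of_mul_lt_mul_left ?_ p2.le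
    linarith
  have b2 : 2 * volume.real (ball x' (2 * r) \ S') < volume.real (ball x r) := by
    refine lt_of_mul_lt_mul_left ?_ p2.le
    linarith
  have hex : ∃ y ∈ ball x r, y ∈ S ∧ y ∈ S' := by
    by_contra! hcon
    have hsub : ball x r ⊆ (ball x (2 * r) \ S) ∪ (ball x' (2 * r) \ S') := by
      intro y hy
      by_cases hyS : y ∈ S
      · refine Or.inr ⟨?_, hcon y hy hyS⟩
        have := dist_triangle y x x'
        rw [mem_ball] at hy ⊢
        linarith
      · exact Or.inl ⟨ball_subset_ball (by linarith) hy, hyS⟩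
    have fin : ∀ (y : Em n) (U : Set (Em n)), volume (ball y (2 * r) \ U) ≠ ∞ := fun y U =>
      ((measure_mono Set.sdiff_subset).trans_lt measure_ball_lt_top).ne
    have c1 := measureReal_mono (μ := volume) hsub (measure_union_lt_top (fin _ _).lt_top
      (fin _ _).lt_top).ne
    have c2 := measureReal_union_le (μ := volume) (ball x (2 * r) \ S) (ball x' (2 * r) \ S')
    linarith
  obtain ⟨y, hy, hyS, hyS'⟩ := hex
  have d1 := hS1 y hyS
  have d2 := hS1' y hyS'
  rw [← dist_eq_norm, ← dist_eq_norm] at d1 d2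
  rw [mem_ball] at hy
  have d3 : dist y x' ≤ 2 * r := by
    have := dist_triangle y x x'
    linarith
  have d4 := dist_triangle_left (h x) (h x') (h y)
  have hj : (0 : ℝ) ≤ j := by positivity
  nlinarith [mul_le_mul_of_nonneg_left hy.le hj, mul_le_mul_of_nonneg_left d3 hj]

lemma exists_lip_cover (h : Em n → Em n) : ∃ A : ℕ → Set (Em n),
    (∀ x L, HasApproxDerivAt h L x → ∃ i, x ∈ A i) ∧ ∀ i, ∃ C : ℝ≥0, LipschitzOnWith C h (A i) := by
  refine ⟨fun i => {x | GoodPt h (Nat.unpair i).1 x} ∩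
    ball (TopologicalSpace.denseSeq (Em n) (Nat.unpair i).2) (1 / (4 * (((Nat.unpair i).1 : ℝ) + 1))), ?_, ?_⟩
  · intro x L hx
    obtain ⟨j, hj⟩ := exists_goodPt hx
    obtain ⟨m, hm⟩ := (TopologicalSpace.denseRange_denseSeq (Em n)).exists_dist_lt x
      (show (0 : ℝ) < 1 / (4 * ((j : ℝ) + 1)) by positivity)
    refine ⟨Nat.pair j m, ?_⟩
    simp only [Nat.unpair_pair]
    exact ⟨hj, hm⟩
  · intro i
    refine ⟨3 * (Nat.unpair i).1, LipschitzOnWith.of_dist_le_mul ?_⟩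
    rintro x ⟨hx, hxb⟩ y ⟨hy, hyb⟩
    have := GoodPt.lip hx hy ?_
    · simpa using this
    · rw [mem_ball] at hxb hyb
      have h1 := dist_triangle_right x y (TopologicalSpace.denseSeq (Em n) (Nat.unpair i).2)
      have : 1 / (2 * (((Nat.unpair i).1 : ℝ) + 1)) =
        1 / (4 * (((Nat.unpair i).1 : ℝ) + 1)) + 1 / (4 * (((Nat.unpair i).1 : ℝ) + 1)) := by
        field_simp; norm_num
      linarith

/-- Decomposition of the domain of an a.e. approximately differentiable map. -/
lemma exists_decomp {h : Em n → Em n} {D : Em n → Em n →L[ℝ] Em n} {Ω : Set (Em n)}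
    (hΩ : MeasurableSet Ω) (hd : ∀ᵐ x ∂(volume.restrict Ω), HasApproxDerivAt h (D x) x) :
    ∃ T : ℕ → Set (Em n), (∀ i, MeasurableSet (T i)) ∧ Pairwise (Function.onFun Disjoint T) ∧
      (∀ i, T i ⊆ Ω) ∧ volume (Ω \ ⋃ i, T i) = 0 ∧
      ∀ i, ∀ x ∈ T i, HasFDerivWithinAt h (D x) (T i) x := by
  obtain ⟨A, hA1, hA2⟩ := exists_lip_cover h
  have step : ∀ i, ∃ T N : Set (Em n), MeasurableSet T ∧ T ⊆ Ω ∧ volume N = 0 ∧ A i ∩ Ω ⊆ T ∪ N ∧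
      ∀ x ∈ T, HasFDerivWithinAt h (D x) T x := by
    intro i
    obtain ⟨C, hC⟩ := hA2 i
    obtain ⟨H, hH, hHA⟩ := hC.extend_finite_dimension
    set B := toMeasurable volume (A i) ∩ Ω with hB
    have hBm : MeasurableSet B := (measurableSet_toMeasurable _ _).inter hΩ
    have e1 : ∀ᵐ x ∂(volume.restrict B), Tendsto (fun r => volume (A i ∩ closedBall x r) /
        volume (closedBall x r)) (𝓝[>] (0 : ℝ)) (𝓝 1) := by
      have := Besicovitch.ae_tendsto_measure_inter_div volume (A i)
      rw [← Measure.restrict_toMeasurable_of_sFinite] at this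
      exact ae_restrict_of_ae_restrict_of_subset inter_subset_left this
    have e2 : ∀ᵐ x ∂(volume.restrict B), HasApproxDerivAt h (D x) x :=
      ae_restrict_of_ae_restrict_of_subset inter_subset_right hd
    have e3 : ∀ᵐ x ∂(volume.restrict B), DifferentiableAt ℝ H x :=
      ae_restrict_of_ae hH.ae_differentiableAt
    have e4 : ∀ᵐ x ∂(volume.restrict B), h x = H x ∧ HasFDerivAt H (D x) x := by
      filter_upwards [e1, e2, e3] with x h1 h2 h3
      obtain ⟨h4, h5⟩ := approx_compare h2 h1 hHA h3
      exact ⟨h4, h5 ▸ h3.hasFDerivAt⟩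
    rw [ae_restrict_iff' hBm, ae_iff] at e4
    obtain ⟨N, hN1, hN2, hN3⟩ := exists_measurable_superset_of_null e4
    refine ⟨B \ N, N, hBm.diff hN2, Set.sdiff_subset.trans inter_subset_right, hN3, ?_, ?_⟩
    · intro x hx
      by_cases hxN : x ∈ N
      · exact Or.inr hxN
      · exact Or.inl ⟨⟨subset_toMeasurable _ _ hx.1, hx.2⟩, hxN⟩
    · have good : ∀ x ∈ B \ N, h x = H x ∧ HasFDerivAt H (D x) x := by
        intro x hx
        by_contra hcon
        exact hx.2 (hN1 (fun h' => hcon (h' hx.1)))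
      intro x hx
      exact (good x hx).2.hasFDerivWithinAt.congr (fun y hy => (good y hy).1) (good x hx).1
  choose T N hT1 hT2 hN hTN hT3 using step
  refine ⟨disjointed T, fun i => MeasurableSet.disjointed hT1 i, disjoint_disjointed T,
    fun i => (disjointed_subset T i).trans (hT2 i), ?_, fun i x hx =>
      (hT3 i x (disjointed_subset T i hx)).mono (disjointed_subset T i)⟩
  rw [iUnion_disjointed]
  rw [ae_restrict_iff' hΩ, ae_iff] at hd
  refine measure_mono_null ?_ (measure_union_null hd (measure_iUnion_null hN))
  rintro x ⟨hx, hxT⟩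
  by_cases hxd : HasApproxDerivAt h (D x) x
  · right
    obtain ⟨i, hi⟩ := hA1 x _ hxd
    rcases hTN i ⟨hi, hx⟩ with h1 | h1
    · exact absurd (mem_iUnion.2 ⟨i, h1⟩) hxT
    · exact mem_iUnion.2 ⟨i, h1⟩
  · left
    exact fun h' => hxd (h' hx)

lemma aemeasurable_of_decomp {h : Em n → Em n} {D : Em n → Em n →L[ℝ] Em n} {K : Set (Em n)}
    (hK : MeasurableSet K) (hd : ∀ᵐ x ∂(volume.restrict K), HasApproxDerivAt h (D x) x) :
    AEMeasurable D (volume.restrict K) := by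
  obtain ⟨T, hT1, hT2, hT3, hT4, hT5⟩ := exists_decomp hK hd
  have e : (⋃ i, T i) =ᵐ[volume] K := by
    refine ae_eq_set.2 ⟨?_, hT4⟩
    rw [Set.sdiff_eq_empty.2 (iUnion_subset hT3), measure_empty]
  rw [← Measure.restrict_congr_set e]
  exact AEMeasurable.iUnion fun i => aemeasurable_fderivWithin volume (hT1 i) (hT5 i)

lemma image_le_lintegral {h : Em n → Em n} {D : Em n → Em n →L[ℝ] Em n} {K : Set (Em n)}
    (hK : MeasurableSet K) (hd : ∀ᵐ x ∂(volume.restrict K), HasApproxDerivAt h (D x) x)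
    (hN : LusinN h K) :
    volume (h '' K) ≤ ∫⁻ x in K, ENNReal.ofReal |(D x).det| := by
  obtain ⟨T, hT1, hT2, hT3, hT4, hT5⟩ := exists_decomp hK hd
  have e : K = (⋃ i, T i) ∪ (K \ ⋃ i, T i) := by
    rw [Set.union_sdiff_cancel (iUnion_subset hT3)]
  calc volume (h '' K) ≤ volume (⋃ i, h '' T i) + volume (h '' (K \ ⋃ i, T i)) := by
        conv_lhs => rw [e, image_union, image_iUnion]
        exact measure_union_le _ _
    _ = volume (⋃ i, h '' T i) := by rw [hN _ Set.sdiff_subset hT4, add_zero]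
    _ ≤ ∑' i, volume (h '' T i) := measure_iUnion_le _
    _ ≤ ∑' i, ∫⁻ x in T i, ENNReal.ofReal |(D x).det| :=
        ENNReal.tsum_le_tsum fun i =>
          addHaar_image_le_lintegral_abs_det_fderiv volume (hT1 i) (hT5 i)
    _ = ∫⁻ x in ⋃ i, T i, ENNReal.ofReal |(D x).det| := (lintegral_iUnion hT1 hT2 _).symm
    _ ≤ _ := lintegral_mono_set (iUnion_subset hT3)

lemma lintegral_le_image {h : Em n → Em n} {D : Em n → Em n →L[ℝ] Em n} {K : Set (Em n)}
    (hK : MeasurableSet K) (hd : ∀ᵐ x ∂(volume.restrict K), HasApproxDerivAt h (D x) x)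
    {N : Set (Em n)} (hN : volume N = 0) (hinj : InjOn h (K \ N)) :
    ∫⁻ x in K, ENNReal.ofReal |(D x).det| ≤ volume (h '' K) := by
  obtain ⟨N', hN1, hN2, hN3⟩ := exists_measurable_superset_of_null hN
  have hKm : MeasurableSet (K \ N') := hK.diff hN2
  have hinj' : InjOn h (K \ N') := hinj.mono (Set.sdiff_subset_sdiff_right hN1)
  obtain ⟨T, hT1, hT2, hT3, hT4, hT5⟩ := exists_decomp hKm
    (ae_restrict_of_ae_restrict_of_subset Set.sdiff_subset hd)
  have e : (⋃ i, T i) =ᵐ[volume] K := by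
    refine ae_eq_set.2 ⟨?_, ?_⟩
    · rw [Set.sdiff_eq_empty.2 (iUnion_subset fun i => (hT3 i).trans Set.sdiff_subset),
        measure_empty]
    · refine measure_mono_null ?_ (measure_union_null hT4 hN3)
      rintro x ⟨hx, hxT⟩
      by_cases hxN : x ∈ N'
      · exact Or.inr hxN
      · exact Or.inl ⟨⟨hx, hxN⟩, hxT⟩
  rw [← Measure.restrict_congr_set e, lintegral_iUnion hT1 hT2]
  have e2 : ∀ i, ∫⁻ x in T i, ENNReal.ofReal |(D x).det| = volume (h '' T i) := fun i =>
    lintegral_abs_det_fderiv_eq_addHaar_image volume (hT1 i) (hT5 i) (hinj'.mono (hT3 i))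
  simp_rw [e2]
  rw [← measure_iUnion]
  · exact measure_mono (iUnion_subset fun i => image_mono ((hT3 i).trans Set.sdiff_subset))
  · intro i j hij
    exact (hT2 hij).image hinj' (hT3 i) (hT3 j)
  · exact fun i => measurable_image_of_fderivWithin (hT1 i) (hT5 i) (hinj'.mono (hT3 i))

theorem stmt8 {n : ℕ} (Ω : Set (Em n)) (hΩo : IsOpen Ω) (hΩc : IsConnected Ω)
    (hΩb : Bornology.IsBounded Ω)
    (f : ℕ → Em n → Em n) (Df : ℕ → Em n → Em n →L[ℝ] Em n)
    (g : Em n → Em n) (Dg : Em n → Em n →L[ℝ] Em n)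
    (hfc : ∀ k, ContinuousOn (f k) Ω)
    (hfinj : ∀ k, InjectiveAE (f k) Ω)
    (hfd : ∀ k, ∀ᵐ x ∂(volume.restrict Ω), HasApproxDerivAt (f k) (Df k x) x)
    (hgN : LusinN g Ω)
    (hgd : ∀ᵐ x ∂(volume.restrict Ω), HasApproxDerivAt g (Dg x) x)
    (hgint : ∀ K ⊆ Ω, IsCompact K → IntegrableOn (fun x => (Dg x).det) K)
    (hDconv : TendstoInMeasure (volume.restrict Ω) (fun k x => Df k x) atTop (fun x => Dg x))
    (himg : ∀ E : Set (Em n), MeasurableSet E → closure E ⊆ Ω →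
      Tendsto (fun k => volume (f k '' E)) atTop (𝓝 (volume (g '' E)))) :
    ∀ K ⊆ Ω, IsCompact K →
      Tendsto (fun k => ∫ x in K, |(Df k x).det - (Dg x).det|) atTop (𝓝 0) := by
  intro K hKΩ hK
  have hKm := hK.measurableSet
  have hG := hgint K hKΩ hK
  have hv := himg K hKm (by rwa [hK.isClosed.closure_eq])
  set G : Em n → ℝ := fun x => (Dg x).det with hGdef
  set F : ℕ → Em n → ℝ := fun k x => (Df k x).det with hFdef
  have hFm : ∀ k, AEStronglyMeasurable (F k) (volume.restrict K) := fun k =>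
    (ContinuousLinearMap.continuous_det.measurable.comp_aemeasurable
      (aemeasurable_of_decomp hKm
        (ae_restrict_of_ae_restrict_of_subset hKΩ (hfd k)))).aestronglyMeasurable
  have hF1 : ∀ k, ∫⁻ x in K, ENNReal.ofReal |F k x| ≤ volume (f k '' K) := by
    intro k
    obtain ⟨N, -, hN, hinj⟩ := hfinj k
    exact lintegral_le_image hKm (ae_restrict_of_ae_restrict_of_subset hKΩ (hfd k)) hN
      (hinj.mono (Set.sdiff_subset_sdiff_left hKΩ))
  have hG1 : volume (g '' K) ≤ ∫⁻ x in K, ENNReal.ofReal |G x| :=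
    image_le_lintegral hKm (ae_restrict_of_ae_restrict_of_subset hKΩ hgd)
      (fun E hE hE0 => hgN E (hE.trans hKΩ) hE0)
  have hGabs : ∫ x in K, |G x| = (∫⁻ x in K, ENNReal.ofReal |G x|).toReal :=
    integral_eq_lintegral_of_nonneg_ae (Eventually.of_forall fun x => abs_nonneg _) hG.abs.1
  have hGfin : ∫⁻ x in K, ENNReal.ofReal |G x| ≠ ∞ := by
    rw [← ofReal_integral_eq_lintegral_ofReal hG.abs (Eventually.of_forall fun x => abs_nonneg _)]
    exact ENNReal.ofReal_ne_top
  have hvfin : volume (g '' K) ≠ ∞ := (hG1.trans_lt hGfin.lt_top).ne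
  have hvG : (volume (g '' K)).toReal ≤ ∫ x in K, |G x| := by
    rw [hGabs]
    exact ENNReal.toReal_mono hGfin hG1
  have hvr : Tendsto (fun k => (volume (f k '' K)).toReal) atTop (𝓝 (volume (g '' K)).toReal) :=
    (ENNReal.tendsto_toReal hvfin).comp hv
  refine tendsto_of_subseq_tendsto fun ns hns => ?_
  obtain ⟨ms, hms, hae⟩ := (hDconv.comp hns).exists_seq_tendsto_ae
  refine ⟨ms, ?_⟩
  have hsub : Tendsto (fun i => ns (ms i)) atTop atTop := hns.comp hms.tendsto_atTop
  have hFG : ∀ᵐ x ∂(volume.restrict K), Tendsto (fun i => F (ns (ms i)) x) atTop (𝓝 (G x)) := by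
    filter_upwards [ae_restrict_of_ae_restrict_of_subset hKΩ hae] with x hx
    exact (ContinuousLinearMap.continuous_det.tendsto _).comp hx
  have hH : Tendsto (fun i => ∫ x in K, (|F (ns (ms i)) x - G x| - |F (ns (ms i)) x| + |G x|))
      atTop (𝓝 (∫ x in K, (0 : ℝ))) := by
    refine tendsto_integral_of_dominated_convergence (fun x => 2 * |G x|) ?_ (hG.abs.const_mul 2)
      ?_ ?_
    · intro i
      exact (((hFm _).sub hG.1).norm.sub (hFm _).norm).add hG.1.norm
    · intro i
      refine Eventually.of_forall fun x => ?_
      have h1 := abs_sub (F (ns (ms i)) x) (G x)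
      have h2 := abs_sub_abs_le_abs_sub (F (ns (ms i)) x) (G x)
      rw [Real.norm_eq_abs, abs_le]
      constructor <;> linarith [abs_nonneg (G x)]
    · filter_upwards [hFG] with x hx
      have h1 := ((hx.sub_const (G x)).abs.sub hx.abs).add_const |G x|
      simpa using h1
  simp only [integral_zero] at hH
  have hfin : ∀ᶠ i in atTop, volume (f (ns (ms i)) '' K) < ∞ :=
    (hv.comp hsub).eventually (gt_mem_nhds hvfin.lt_top)
  have hup : Tendsto (fun i => (volume (f (ns (ms i)) '' K)).toReal - (volume (g '' K)).toReal +
      ∫ x in K, (|F (ns (ms i)) x - G x| - |F (ns (ms i)) x| + |G x|)) atTop (𝓝 0) := by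
    have := ((hvr.comp hsub).sub_const (volume (g '' K)).toReal).add hH
    simpa using this
  refine tendsto_of_tendsto_of_tendsto_of_le_of_le' tendsto_const_nhds hup
    (Eventually.of_forall fun i => integral_nonneg fun x => abs_nonneg _) ?_
  filter_upwards [hfin] with i hi
  have hFint : IntegrableOn (F (ns (ms i))) K := by
    refine ⟨hFm _, ?_⟩
    rw [hasFiniteIntegral_iff_norm]
    exact (hF1 _).trans_lt hi
  have hFle : ∫ x in K, |F (ns (ms i)) x| ≤ (volume (f (ns (ms i)) '' K)).toReal := by
    rw [integral_eq_lintegral_of_nonneg_ae (Eventually.of_forall fun x => abs_nonneg _)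
      hFint.abs.1]
    exact ENNReal.toReal_mono hi.ne (hF1 _)
  have hsplit : ∫ x in K, (|F (ns (ms i)) x - G x| - |F (ns (ms i)) x| + |G x|) =
      (∫ x in K, |F (ns (ms i)) x - G x|) - (∫ x in K, |F (ns (ms i)) x|) + ∫ x in K, |G x| := by
    have i1 : Integrable (fun x => |F (ns (ms i)) x - G x|) (volume.restrict K) :=
      (hFint.sub hG).abs
    have i2 : Integrable (fun x => |F (ns (ms i)) x|) (volume.restrict K) := hFint.abs
    have i3 : Integrable (fun x => |F (ns (ms i)) x - G x| - |F (ns (ms i)) x|)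
      (volume.restrict K) := i1.sub i2
    rw [integral_add i3 hG.abs, integral_sub i1 i2]
  rw [hsplit]
  linarith
end
end

section
/- Let Ω ⊆ ℝⁿ (n ≥ 2) be a bounded domain, p > n−1 if n ≥ 3 and p ≥ 1 if n = 2. Let f_k : Ω → ℝⁿ be homeomorphisms onto their images and f : Ω → ℝⁿ be continuous. If f_k → f in W^{1,p}_loc(Ω, ℝⁿ), then f_k → f locally uniformly on Ω. -/
open MeasureTheory Metric Filter Topology Set
open scoped ENNReal NNReal Topology

noncomputable section

variable {n : ℕ}

/-! ### Part A: a continuous compactly supported perturbation of the identity has a zero -/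

/-- Integrating a polynomial with continuous coefficients gives a polynomial. -/
lemma exists_poly_integral {n : ℕ} (P : Polynomial C(Em n, ℝ)) (B : Set (Em n))
    (hB : IsCompact B) : ∃ Q : Polynomial ℝ, ∀ t : ℝ,
      ∫ x in B, Polynomial.eval₂ (ContinuousMap.evalAlgHom ℝ ℝ x).toRingHom t P = Q.eval t := by
  refine ⟨∑ i ∈ Finset.range (P.natDegree + 1),
    Polynomial.monomial i (∫ x in B, P.coeff i x), fun t => ?_⟩
  simp only [Polynomial.eval₂_eq_sum_range, Polynomial.eval_finsetSum, Polynomial.eval_monomial]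
  rw [integral_finsetSum]
  · refine Finset.sum_congr rfl fun i _ => ?_
    rw [← integral_mul_const]
    rfl
  · intro i _
    refine Integrable.mul_const ?_ _
    exact (P.coeff i).continuous.continuousOn.integrableOn_compact hB

lemma exists_poly_det {n : ℕ} (v : Em n → Em n) (hv : ContDiff ℝ 1 v) (M : ℝ) (N : ℕ)
    (B : Set (Em n)) (hB : IsCompact B) : ∃ Q : Polynomial ℝ, ∀ t : ℝ,
      ∫ x in B, ContinuousLinearMap.det (ContinuousLinearMap.id ℝ (Em n) + t • fderiv ℝ v x) *
        (1 - M * ‖x + t • v x‖ ^ 2) ^ N = Q.eval t := by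
  have hd : Continuous (fderiv ℝ v) := hv.continuous_fderiv (by norm_num)
  have hvc := hv.continuous
  let b := (EuclideanSpace.basisFun (Fin n) ℝ).toBasis
  let A : Matrix (Fin n) (Fin n) C(Em n, ℝ) := Matrix.of fun i j =>
    ⟨fun x => (fderiv ℝ v x (b j)) i, by fun_prop⟩
  let cx : Fin n → C(Em n, ℝ) := fun i => ⟨fun x => x i, by fun_prop⟩
  let cv : Fin n → C(Em n, ℝ) := fun i => ⟨fun x => v x i, by fun_prop⟩
  let P : Polynomial C(Em n, ℝ) :=
    Matrix.det ((1 : Matrix (Fin n) (Fin n) (Polynomial C(Em n, ℝ))) +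
        (Polynomial.X : Polynomial C(Em n, ℝ)) • A.map Polynomial.C) *
      (1 - Polynomial.C (ContinuousMap.const _ M) *
        ∑ i, (Polynomial.C (cx i) + Polynomial.X * Polynomial.C (cv i)) ^ 2) ^ N
  obtain ⟨Q, hQ⟩ := exists_poly_integral P B hB
  refine ⟨Q, fun t => ?_⟩
  rw [← hQ]
  congr 1
  ext x
  change _ = Polynomial.eval₂RingHom (ContinuousMap.evalAlgHom ℝ ℝ x).toRingHom t P
  simp only [P, map_mul, RingHom.map_det, map_pow, map_sub, map_one, map_sum, map_add]
  congr 1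
  · rw [ContinuousLinearMap.det, ← LinearMap.det_toMatrix b]
    congr 1
    ext i j
    simp [LinearMap.toMatrix_apply, A, b, Matrix.one_apply, Matrix.map_apply]
    ring
  · congr 1
    simp [EuclideanSpace.norm_sq_eq, cx, cv]


/-- Change of variables for a small perturbation of the identity. -/
lemma small_change {n : ℕ} (v : Em n → Em n) (hv : ContDiff ℝ 1 v) (R : ℝ)
    (hR : ∀ x, R < ‖x‖ → v x = 0) (L : ℝ≥0) (hL : LipschitzWith L v) (ρ : Em n → ℝ) :
    ∃ δ > 0, ∀ t ∈ Ioo (0 : ℝ) δ,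
      ∫ x in closedBall (0 : Em n) R,
        ContinuousLinearMap.det (ContinuousLinearMap.id ℝ (Em n) + t • fderiv ℝ v x) *
          ρ (x + t • v x) = ∫ x in closedBall (0 : Em n) R, ρ x := by
  have hdet : ∀ᶠ A in 𝓝 (ContinuousLinearMap.id ℝ (Em n)), 0 < ContinuousLinearMap.det A := by
    apply (ContinuousLinearMap.continuous_det (𝕜 := ℝ) (E := Em n)).continuousAt.eventually_const_lt
    simp [ContinuousLinearMap.det]
  obtain ⟨δ₀, hδ₀, hδ⟩ := Metric.eventually_nhds_iff.1 hdet
  have hLp : (0 : ℝ) < L + 1 := by positivity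
  refine ⟨min δ₀ 1 / (L + 1), by positivity, fun t ht => ?_⟩
  have htL : t * (L + 1) < min δ₀ 1 := (lt_div_iff₀ hLp).1 ht.2
  have ht0 : 0 < t := ht.1
  have htL1 : t * L < 1 := by
    have := htL.trans_le (min_le_right _ _); nlinarith
  have htLδ : t * L < δ₀ := by
    have := htL.trans_le (min_le_left _ _); nlinarith
  have hdist : ∀ x y, ‖v x - v y‖ ≤ L * ‖x - y‖ := fun x y => by
    simpa [dist_eq_norm] using hL.dist_le_mul x y
  have hinj : Function.Injective (fun x => x + t • v x) := by
    intro x y hxy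
    by_contra hne
    have h1 : x - y = t • (v y - v x) := by
      rw [smul_sub, sub_eq_sub_iff_add_eq_add]
      simpa [add_comm] using hxy
    have h2 : ‖x - y‖ ≤ t * (L * ‖x - y‖) := by
      conv_lhs => rw [h1, norm_smul, Real.norm_of_nonneg ht0.le, norm_sub_rev]
      exact mul_le_mul_of_nonneg_left (hdist x y) ht0.le
    have h3 : 0 < ‖x - y‖ := norm_pos_iff.2 (sub_ne_zero.2 hne)
    nlinarith
  have hsurj : Function.Surjective (fun x => x + t • v x) := by
    intro y
    have hc : ContractingWith (⟨t * L, by positivity⟩ : ℝ≥0) (fun x => y - t • v x) := by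
      refine ⟨NNReal.coe_lt_coe.1 htL1, LipschitzWith.of_dist_le_mul fun a b => ?_⟩
      rw [dist_eq_norm, dist_eq_norm, sub_sub_sub_cancel_left, ← smul_sub, norm_smul,
        Real.norm_of_nonneg ht0.le, norm_sub_rev a b]
      change _ ≤ t * L * _
      rw [mul_assoc]
      exact mul_le_mul_of_nonneg_left (hdist b a) ht0.le
    obtain ⟨z, hz⟩ : ∃ z, y - t • v z = z := ⟨_, hc.fixedPoint_isFixedPt⟩
    exact ⟨z, (sub_eq_iff_eq_add.1 hz).symm⟩
  have himg : (fun x => x + t • v x) '' closedBall (0 : Em n) R = closedBall (0 : Em n) R := by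
    have hout : ∀ x, x ∉ closedBall (0 : Em n) R → x + t • v x = x := by
      intro x hx
      rw [hR x (by simpa using hx)]; simp
    apply Subset.antisymm
    · rintro _ ⟨x, hx, rfl⟩
      by_contra hy
      exact hy (by have := hinj (hout _ hy); simp only at this ⊢; rw [this]; exact hx)
    · intro y hy
      obtain ⟨x, rfl⟩ := hsurj y
      refine ⟨x, ?_, rfl⟩
      by_contra hx
      simp only [hout x hx] at hy
      exact hx hy
  conv_rhs => rw [← himg]
  rw [integral_image_eq_integral_abs_det_fderiv_smul volume measurableSet_closedBall
    (f' := fun x => ContinuousLinearMap.id ℝ (Em n) + t • fderiv ℝ v x) _ hinj.injOn]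
  · refine integral_congr_ae (ae_of_all _ fun x => ?_)
    simp only [smul_eq_mul]
    rw [abs_of_pos]
    apply hδ
    rw [dist_eq_norm, add_sub_cancel_left, norm_smul, Real.norm_of_nonneg ht0.le]
    refine lt_of_le_of_lt (mul_le_mul_of_nonneg_left ?_ ht0.le) htLδ
    exact norm_fderiv_le_of_lipschitz ℝ hL
  · intro x _
    refine ((hasFDerivAt_id x).add (HasFDerivAt.const_smul ?_ t)).hasFDerivWithinAt
    exact (hv.differentiable (by norm_num) x).hasFDerivAt

lemma exists_zero_contDiff {n : ℕ} (v : Em n → Em n) (hv : ContDiff ℝ 1 v)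
    (hc : HasCompactSupport v) : ∃ x, x + v x = 0 := by
  by_contra! hne
  obtain ⟨L, hL⟩ := hv.lipschitzWith_of_hasCompactSupport hc (by norm_num)
  obtain ⟨R, hR0, hR⟩ := hc.isCompact.isBounded.exists_pos_norm_le
  have hR' : ∀ x, R < ‖x‖ → v x = 0 := by
    intro x hx
    by_contra h
    exact absurd (hR x (subset_tsupport _ h)) (not_le.2 hx)
  set B := closedBall (0 : Em n) R with hBdef
  have hB : IsCompact B := isCompact_closedBall _ _
  have hcont : Continuous fun x => x + v x := continuous_id.add hv.continuous
  obtain ⟨x₀, hx₀, hmin⟩ := hB.exists_isMinOn (nonempty_closedBall.2 hR0.le)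
    (hcont.norm.continuousOn)
  set ε := ‖x₀ + v x₀‖ with hε
  have hε0 : 0 < ε := norm_pos_iff.2 (hne x₀)
  obtain ⟨M₀, hM₀⟩ := hB.exists_bound_of_continuousOn hcont.continuousOn
  set M := max (max M₀ R) ε + 1 with hM
  have hMM : M₀ ≤ M := by have := le_max_left M₀ R; have := le_max_left (max M₀ R) ε; linarith
  have hMR : R ≤ M := by have := le_max_right M₀ R; have := le_max_left (max M₀ R) ε; linarith
  have hMε : ε ≤ M := by have := le_max_right (max M₀ R) ε; linarith
  have hM0 : 0 < M := hR0.trans_le hMR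
  let c : ℝ := (M ^ 2)⁻¹
  have hc0 : 0 < c := by positivity
  have hcM : c * M ^ 2 = 1 := inv_mul_cancel₀ (by positivity)
  -- the identity for all N
  have key : ∀ N : ℕ, ∫ x in B, ContinuousLinearMap.det
      (ContinuousLinearMap.id ℝ (Em n) + fderiv ℝ v x) * (1 - c * ‖x + v x‖ ^ 2) ^ N =
      ∫ x in B, (1 - c * ‖x‖ ^ 2) ^ N := by
    intro N
    obtain ⟨Q, hQ⟩ := exists_poly_det v hv c N B hB
    obtain ⟨δ, hδ, h⟩ := small_change v hv R hR' L hL (fun y => (1 - c * ‖y‖ ^ 2) ^ N)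
    have hQc : Q = Polynomial.C (∫ x in B, (1 - c * ‖x‖ ^ 2) ^ N) := by
      apply Polynomial.eq_of_infinite_eval_eq
      refine (Ioo_infinite hδ).mono fun t ht => ?_
      simp only [Set.mem_ofPred_eq, Polynomial.eval_C]
      rw [← hQ, ← h t ht]
    have := hQ 1
    rw [hQc] at this
    simpa using this
  have hdc : Continuous fun x => ContinuousLinearMap.det
      (ContinuousLinearMap.id ℝ (Em n) + fderiv ℝ v x) :=
    ContinuousLinearMap.continuous_det.comp
      (continuous_const.add (hv.continuous_fderiv (by norm_num)))
  obtain ⟨D, hD⟩ := hB.exists_bound_of_continuousOn hdc.continuousOn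
  set q := 1 - c * ε ^ 2 with hq
  set q' := 1 - c * (ε / 2) ^ 2 with hq'
  have hcε : c * ε ^ 2 ≤ 1 := by rw [← hcM]; gcongr
  have hcε0 : 0 < c * ε ^ 2 := by positivity
  have hq0 : 0 ≤ q := by linarith
  have hqq : q < q' := by rw [hq, hq']; nlinarith
  have hq'0 : 0 < q' := hq0.trans_lt hqq
  have hup : ∀ N : ℕ, ∫ x in B, (1 - c * ‖x‖ ^ 2) ^ N ≤ D * volume.real B * q ^ N := by
    intro N
    rw [← key]
    refine (le_abs_self _).trans ?_
    rw [← Real.norm_eq_abs]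
    have := norm_setIntegral_le_of_norm_le_const (μ := volume) (s := B) (C := D * q ^ N)
      (f := fun x => ContinuousLinearMap.det
      (ContinuousLinearMap.id ℝ (Em n) + fderiv ℝ v x) * (1 - c * ‖x + v x‖ ^ 2) ^ N)
      hB.measure_lt_top ?_
    · refine this.trans (le_of_eq ?_); ring
    · intro x hx
      rw [norm_mul, norm_pow]
      have h1 : c * ‖x + v x‖ ^ 2 ≤ 1 := by
        rw [← hcM]; have := (hM₀ x hx).trans hMM; gcongr
      have h2 : c * ε ^ 2 ≤ c * ‖x + v x‖ ^ 2 := by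
        have : ε ≤ ‖x + v x‖ := hmin hx
        gcongr
      have h3 : ‖1 - c * ‖x + v x‖ ^ 2‖ ≤ q := by
        rw [Real.norm_of_nonneg (by linarith)]; linarith
      have h4 := hD x hx
      have : 0 ≤ D := (norm_nonneg _).trans h4
      gcongr
  set r := min (ε / 2) R with hr
  have hr0 : 0 < r := by positivity
  have hlow : ∀ N : ℕ, volume.real (closedBall (0 : Em n) r) * q' ^ N ≤
      ∫ x in B, (1 - c * ‖x‖ ^ 2) ^ N := by
    intro N
    have hi : IntegrableOn (fun x : Em n => (1 - c * ‖x‖ ^ 2) ^ N) B :=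
      (by fun_prop : Continuous fun x : Em n => (1 - c * ‖x‖ ^ 2) ^ N).continuousOn.integrableOn_compact hB
    have hsub : closedBall (0 : Em n) r ⊆ B := closedBall_subset_closedBall (min_le_right _ _)
    have hnn : ∀ x ∈ B, 0 ≤ (1 - c * ‖x‖ ^ 2) ^ N := by
      intro x hx
      have hx' : ‖x‖ ≤ R := by simpa [B] using hx
      have h1 : c * ‖x‖ ^ 2 ≤ 1 := by
        rw [← hcM]; have := hx'.trans hMR; gcongr
      exact pow_nonneg (by linarith) _
    calc volume.real (closedBall (0 : Em n) r) * q' ^ N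
        = ∫ x in closedBall (0 : Em n) r, q' ^ N := by simp
      _ ≤ ∫ x in closedBall (0 : Em n) r, (1 - c * ‖x‖ ^ 2) ^ N := by
          apply setIntegral_mono_on _ (hi.mono_set hsub) measurableSet_closedBall
          · intro x hx
            have hx' : ‖x‖ ≤ ε / 2 := (by simpa using hx : ‖x‖ ≤ r).trans (min_le_left _ _)
            have : c * ‖x‖ ^ 2 ≤ c * (ε / 2) ^ 2 := by gcongr
            exact pow_le_pow_left₀ hq'0.le (by linarith) _
          · simp [isCompact_closedBall (0 : Em n) r |>.measure_lt_top]
      _ ≤ _ := by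
          apply setIntegral_mono_set hi
          · exact (ae_restrict_mem measurableSet_closedBall).mono fun x hx => hnn x hx
          · exact hsub.eventuallyLE
  have hvol : 0 < volume.real (closedBall (0 : Em n) r) :=
    ENNReal.toReal_pos (measure_closedBall_pos _ _ hr0).ne'
      (isCompact_closedBall _ _).measure_lt_top.ne
  have hlim : Tendsto (fun N : ℕ => D * volume.real B * (q / q') ^ N) atTop (𝓝 0) := by
    simpa using (tendsto_pow_atTop_nhds_zero_of_lt_one (by positivity)
      ((div_lt_one hq'0).2 hqq)).const_mul (D * volume.real B)
  obtain ⟨N, hN⟩ := (hlim.eventually_lt_const hvol).exists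
  have := (hlow N).trans (hup N)
  have hqN : 0 < q' ^ N := by positivity
  rw [div_pow, ← mul_div_assoc, div_lt_iff₀ hqN] at hN
  linarith

/-- Continuous version. -/
lemma exists_zero_continuous {n : ℕ} (w : Em n → Em n) (hw : Continuous w)
    (hc : HasCompactSupport w) : ∃ x, x + w x = 0 := by
  by_contra! hne
  obtain ⟨v, hv, hvw, hs⟩ := hw.exists_contDiff_approx 1
    (ε := fun x => ‖x + w x‖) (by fun_prop) (fun x => norm_pos_iff.2 (hne x))
  obtain ⟨x, hx⟩ := exists_zero_contDiff v (by exact_mod_cast hv) (hc.mono hs)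
  have := hvw x
  rw [dist_eq_norm, ← norm_neg] at this
  have e : -(v x - w x) = x + w x := by
    rw [neg_sub, sub_eq_add_neg, ← eq_neg_of_add_eq_zero_left hx, add_comm]
  rw [e] at this
  exact lt_irrefl _ this

/-- If `h` is close to the identity on a ball then it has a zero there. -/
lemma exists_zero_ball {n : ℕ} (h : Em n → Em n) (r : ℝ) (hr : 0 < r)
    (hh : ContinuousOn h (closedBall 0 r)) (hd : ∀ x ∈ closedBall (0 : Em n) r, ‖h x - x‖ < r) :
    ∃ x ∈ closedBall (0 : Em n) r, h x = 0 := by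
  obtain ⟨G, hG⟩ := ContinuousMap.exists_restrict_eq (isClosed_closedBall (x := (0 : Em n)) (ε := r))
    ⟨fun x : closedBall (0 : Em n) r => h x - x,
      (continuousOn_iff_continuous_domRestrict.1 hh).sub continuous_subtype_val⟩
  have hGx : ∀ x ∈ closedBall (0 : Em n) r, G x = h x - x := fun x hx =>
    congrArg (fun F : C(closedBall (0 : Em n) r, Em n) => F ⟨x, hx⟩) hG
  obtain ⟨χ, hχ1, hχc, hχs, hχ⟩ := exists_continuousMap_one_of_isCompact_subset_isOpen
    (isCompact_closedBall (0 : Em n) r) (isOpen_lt G.continuous.norm (continuous_const (y := r)))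
    (fun x hx => by simpa [hGx x hx] using hd x hx)
  obtain ⟨x, hx⟩ := exists_zero_continuous (fun x => χ x • G x) (by fun_prop)
    (HasCompactSupport.smul_right (f := χ) hχc)
  have hw : ‖χ x • G x‖ < r := by
    by_cases hxs : x ∈ tsupport χ
    · have h1 : ‖G x‖ < r := hχs hxs
      rw [norm_smul, Real.norm_of_nonneg (hχ x).1]
      exact (mul_le_of_le_one_left (norm_nonneg _) (hχ x).2).trans_lt h1
    · rw [image_eq_zero_of_notMem_tsupport hxs]; simpa using hr
  have hxr : x ∈ closedBall (0 : Em n) r := by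
    rw [mem_closedBall_zero_iff, eq_neg_of_add_eq_zero_left hx, norm_neg]
    exact hw.le
  refine ⟨x, hxr, ?_⟩
  have h1 := hχ1 hxr
  simp only [Pi.one_apply] at h1
  simpa [h1, hGx x hxr] using hx

/-- Invariance of domain, at the centre of a closed ball. -/
lemma image_mem_nhds_zero {n : ℕ} (f : Em n → Em n) (r : ℝ) (hr : 0 < r)
    (hf : ContinuousOn f (closedBall 0 r)) (hinj : InjOn f (closedBall 0 r)) :
    f '' closedBall 0 r ∈ 𝓝 (f 0) := by
  set D := closedBall (0 : Em n) r with hD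
  have hDc : IsCompact D := isCompact_closedBall _ _
  have h0D : (0 : Em n) ∈ D := by simp [D, hr.le]
  have hemb : IsClosedEmbedding (D.domRestrict f) := by
    have : CompactSpace D := isCompact_iff_compactSpace.1 hDc
    exact (continuousOn_iff_continuous_domRestrict.1 hf).isClosedEmbedding
      (injOn_iff_injective.1 hinj)
  obtain ⟨G, hG'⟩ := ContinuousMap.exists_extension hemb ⟨fun x : D => (x : Em n), by fun_prop⟩
  have hG : ∀ x ∈ D, G (f x) = x := fun x hx =>
    congrArg (fun F : C(D, Em n) => F ⟨x, hx⟩) hG'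
  by_contra hnot
  have hG0 : ContinuousAt G (f 0) := G.continuous.continuousAt
  obtain ⟨δ₀, hδ₀, hGδ⟩ := Metric.continuousAt_iff.1 hG0 (r / 4) (by positivity)
  rw [hG 0 h0D] at hGδ
  set δ := δ₀ / 2 with hδ
  have hδ0 : 0 < δ := by positivity
  obtain ⟨c, hcδ, hcf⟩ : ∃ c ∈ ball (f 0) δ, c ∉ f '' D := by
    by_contra! hcon
    exact hnot (mem_of_superset (ball_mem_nhds _ hδ0) hcon)
  have hfD : IsCompact (f '' D) := hDc.image_of_continuousOn hf
  have hS1 : IsCompact (f '' D \ ball c δ) := hfD.diff isOpen_ball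
  have hne : ∀ y ∈ f '' D \ ball c δ, G y ≠ 0 := by
    rintro _ ⟨⟨x, hx, rfl⟩, hy⟩ h
    rw [hG x hx] at h
    subst h
    exact hy (by rw [mem_ball_comm]; exact hcδ)
  obtain ⟨ε, hε0, hε⟩ : ∃ ε > 0, ∀ y ∈ f '' D \ ball c δ, ε ≤ ‖G y‖ := by
    rcases (f '' D \ ball c δ).eq_empty_or_nonempty with he | hne'
    · exact ⟨1, one_pos, by simp [he]⟩
    · obtain ⟨y, hy, hmin⟩ := hS1.exists_isMinOn hne' G.continuous.norm.continuousOn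
      exact ⟨‖G y‖, norm_pos_iff.2 (hne y hy), fun z hz => hmin hz⟩
  set m := min ε (r / 4) with hm
  have hm0 : 0 < m := by positivity
  obtain ⟨P, hP, hPG, -⟩ := G.continuous.exists_contDiff_approx 1 (ε := fun _ => m / 2)
    continuous_const (fun _ => by positivity)
  have hPd : Differentiable ℝ P := hP.differentiable (by norm_num)
  have hnull : volume (P '' sphere c δ) = 0 :=
    addHaar_image_eq_zero_of_differentiableOn_of_addHaar_eq_zero volume hPd.differentiableOn
      (Measure.addHaar_sphere_of_ne_zero volume c hδ0.ne')
  obtain ⟨a, ha, haP⟩ : ∃ a ∈ ball (0 : Em n) (m / 2), a ∉ P '' sphere c δ := by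
    by_contra! hcon
    have := (measure_ball_pos volume (0 : Em n) (half_pos hm0)).trans_le (measure_mono hcon)
    exact this.ne' hnull
  rw [mem_ball_zero_iff] at ha
  let π : Em n → Em n := fun y => c + max (δ / ‖y - c‖) 1 • (y - c)
  have hπ : ContinuousOn π {y | y ≠ c} := by
    intro y hy
    have : ‖y - c‖ ≠ 0 := norm_ne_zero_iff.2 (sub_ne_zero.2 hy)
    have hh : ContinuousAt π y := by
      have h1 : ContinuousAt (fun y : Em n => δ / ‖y - c‖) y :=
        ContinuousAt.div continuousAt_const (by fun_prop) this
      have h2 : ContinuousAt (fun y : Em n => max (δ / ‖y - c‖) 1) y :=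
        ContinuousAt.sup h1 continuousAt_const
      have h3 : ContinuousAt (fun y : Em n => y - c) y := by fun_prop
      exact continuousAt_const.add (h2.smul h3)
    exact hh.continuousWithinAt
  have hfc : ∀ x ∈ D, f x ≠ c := fun x hx h => hcf ⟨x, hx, h⟩
  have hπ1 : ∀ y, y ∉ ball c δ → π y = y := by
    intro y hy
    have h1 : δ ≤ ‖y - c‖ := by simpa [dist_eq_norm] using hy
    have h2 : δ / ‖y - c‖ ≤ 1 := div_le_one_of_le₀ h1 (norm_nonneg _)
    simp [π, max_eq_right h2]
  have hπ2 : ∀ y ∈ ball c δ, y ≠ c → π y ∈ sphere c δ := by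
    intro y hy hyc
    have h0 : 0 < ‖y - c‖ := norm_pos_iff.2 (sub_ne_zero.2 hyc)
    have h1 : ‖y - c‖ < δ := by simpa [dist_eq_norm] using hy
    have h2 : 1 ≤ δ / ‖y - c‖ := (one_le_div h0).2 h1.le
    simp only [π, max_eq_left h2, mem_sphere_iff_norm, add_sub_cancel_left, norm_smul]
    rw [Real.norm_of_nonneg (by positivity), div_mul_cancel₀ _ h0.ne']
  have hPG' : ∀ y, ‖P y - a - G y‖ < m := by
    intro y
    have h1 := hPG y
    rw [dist_eq_norm] at h1
    have : P y - a - G y = (P y - G y) - a := by abel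
    rw [this]
    linarith [norm_sub_le (P y - G y) a]
  have hmr : m ≤ r / 4 := min_le_right _ _
  have hcon : ContinuousOn (fun x => P (π (f x)) - a) (closedBall 0 r) :=
    ContinuousOn.sub (hPd.continuous.comp_continuousOn (hπ.comp hf hfc)) continuousOn_const
  have hdist : ∀ x ∈ closedBall (0 : Em n) r, ‖P (π (f x)) - a - x‖ < r := by
    intro x hx
    by_cases hb : f x ∈ ball c δ
    · have h1 := hPG' (π (f x))
      have hs := hπ2 _ hb (hfc x hx)
      have h2 : ‖G (π (f x))‖ < r / 4 := by
        rw [← dist_zero_right]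
        apply hGδ
        calc dist (π (f x)) (f 0) ≤ dist (π (f x)) c + dist c (f 0) := dist_triangle _ _ _
          _ < δ + δ := by rw [mem_sphere.1 hs]; have := mem_ball.1 hcδ; linarith
          _ = δ₀ := by rw [hδ]; ring
      have h3 : ‖G (f x)‖ < r / 4 := by
        rw [← dist_zero_right]
        apply hGδ
        calc dist (f x) (f 0) ≤ dist (f x) c + dist c (f 0) := dist_triangle _ _ _
          _ < δ + δ := by have := mem_ball.1 hcδ; have := mem_ball.1 hb; linarith
          _ = δ₀ := by rw [hδ]; ring
      have h4 : P (π (f x)) - a - x = (P (π (f x)) - a - G (π (f x))) + G (π (f x)) - G (f x) := by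
        rw [hG x hx]; abel
      rw [h4]
      have h5 := norm_sub_le ((P (π (f x)) - a - G (π (f x))) + G (π (f x))) (G (f x))
      have h6 := norm_add_le (P (π (f x)) - a - G (π (f x))) (G (π (f x)))
      linarith
    · rw [hπ1 _ hb]
      have h1 := hPG' (f x)
      rw [hG x hx] at h1
      linarith
  obtain ⟨x, hx, hx0⟩ := exists_zero_ball (fun x => P (π (f x)) - a) r hr hcon hdist
  · by_cases hb : f x ∈ ball c δ
    · exact haP ⟨π (f x), hπ2 _ hb (hfc x hx), sub_eq_zero.1 hx0⟩
    · simp only [hπ1 _ hb] at hx0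
      have h1 := hPG' (f x)
      rw [hx0, zero_sub, norm_neg] at h1
      have h2 := hε (f x) ⟨⟨x, hx, rfl⟩, hb⟩
      exact absurd (h1.trans_le (min_le_left _ _)) (not_lt.2 h2)

/-- Maximum principle for injective continuous maps. -/
lemma exists_max_frontier {n : ℕ} (hn : 0 < n) (f : Em n → Em n) (K : Set (Em n))
    (hK : IsCompact K) (hKne : K.Nonempty) (hf : ContinuousOn f K) (hinj : InjOn f K) (c : Em n) :
    ∃ x ∈ K, x ∉ interior K ∧ ∀ y ∈ K, ‖f y - c‖ ≤ ‖f x - c‖ := by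
  obtain ⟨x, hx, hmax⟩ := hK.exists_isMaxOn hKne (hf.sub (continuousOn_const (c := c))).norm
  refine ⟨x, hx, fun hIntg => ?_, fun y hy => hmax hy⟩
  obtain ⟨r, hr, hrK⟩ := Metric.nhds_basis_closedBall.mem_iff.1 (mem_interior_iff_mem_nhds.1 hIntg)
  have hmaps : MapsTo (fun z => x + z) (closedBall (0 : Em n) r) K := fun z hz =>
    hrK (by simpa using hz)
  have h1 := image_mem_nhds_zero (fun z => f (x + z)) r hr
    (hf.comp (by fun_prop) hmaps)
    (fun a ha b hb hab => add_left_cancel (hinj (hmaps ha) (hmaps hb) hab))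
  simp only [add_zero] at h1
  have h2 : closedBall c ‖f x - c‖ ∈ 𝓝 (f x) := by
    refine mem_of_superset h1 ?_
    rintro _ ⟨z, hz, rfl⟩
    rw [mem_closedBall_iff_norm]
    exact hmax (hmaps hz)
  have h3 : f x ∈ interior (closedBall c ‖f x - c‖) := mem_interior_iff_mem_nhds.2 h2
  have : Nonempty (Fin n) := ⟨⟨0, hn⟩⟩
  rw [interior_closedBall', mem_ball_iff_norm] at h3
  exact lt_irrefl _ h3


/-! ### Part B: Morrey's inequality on a cube -/

lemma holder_one {α : Type*} [MeasurableSpace α] (μ : Measure α) (φ : α → ℝ≥0∞)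
    (hφ : AEMeasurable φ μ) (p : ℝ) (hp : 1 ≤ p) :
    ∫⁻ x, φ x ∂μ ≤ (∫⁻ x, φ x ^ p ∂μ) ^ (1 / p) * μ univ ^ (1 - 1 / p) := by
  rcases hp.eq_or_lt with rfl | hp
  · simp
  · have hc := Real.HolderConjugate.conjExponent hp
    have := ENNReal.lintegral_mul_le_Lp_mul_Lq μ hc hφ (g := fun _ => 1) aemeasurable_const
    simp only [Pi.mul_apply, mul_one, ENNReal.one_rpow, lintegral_const, one_mul] at this
    refine this.trans (le_of_eq ?_)
    congr 2
    have := hc.inv_add_inv_eq_one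
    rw [one_div, one_div]; linarith

lemma lintegral_comp_homothety {m : ℕ} (x : Fin m → ℝ) (t : ℝ) (ht : t ≠ 0)
    (G : (Fin m → ℝ) → ℝ≥0∞) (hG : Measurable G) :
    ∫⁻ y, G (x + t • (y - x)) = ENNReal.ofReal (|(t ^ m)⁻¹|) * ∫⁻ z, G z := by
  rw [lintegral_sub_right_eq_self (fun y => G (x + t • y)) x]
  have hm := Measure.map_addHaar_smul (volume : Measure (Fin m → ℝ)) ht
  have h1 : ∫⁻ y, G (x + t • y) = ∫⁻ z, G (x + z) ∂(Measure.map (t • ·) volume) := by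
    rw [lintegral_map (by fun_prop) (by fun_prop)]
  rw [h1, hm, lintegral_smul_measure, lintegral_add_left_eq_self (fun z => G z) x]
  simp

lemma segment_mem_cube {m : ℕ} {a x y : Fin m → ℝ} {ρ t : ℝ} (hx : x ∈ closedBall a ρ)
    (hy : y ∈ closedBall a ρ) (ht : t ∈ Ioc (0 : ℝ) 1) : x + t • (y - x) ∈ closedBall a ρ :=
  (convex_closedBall a ρ).add_smul_sub_mem hx hy ⟨ht.1.le, ht.2⟩

lemma kernel_bound_gt {m : ℕ} (p : ℝ) (hp : 1 ≤ p) (hmp : (m : ℝ) < p) (a : Fin m → ℝ) (ρ : ℝ) :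
    ∃ C : ℝ≥0∞, C ≠ ∞ ∧ ∀ φ : (Fin m → ℝ) → ℝ≥0∞, Measurable φ → ∀ x ∈ closedBall a ρ,
      ∫⁻ y in closedBall a ρ, ∫⁻ t in Ioc (0 : ℝ) 1, φ (x + t • (y - x)) * ‖y - x‖ₑ ≤
        C * (∫⁻ z in closedBall a ρ, φ z ^ p) ^ (1 / p) := by
  set Q := closedBall a ρ with hQ
  have hp0 : 0 < p := by linarith
  have hQfin : volume Q ≠ ∞ := (isCompact_closedBall a ρ).measure_lt_top.ne
  set I : ℝ≥0∞ := ∫⁻ t in Ioc (0 : ℝ) 1, ENNReal.ofReal (t ^ (-(m / p))) with hI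
  have hIfin : I ≠ ∞ := by
    have h1 : IntervalIntegrable (fun t : ℝ => t ^ (-(m / p))) volume 0 1 := by
      apply intervalIntegral.intervalIntegrable_rpow'
      rw [neg_lt_neg_iff, div_lt_one hp0]; exact hmp
    rw [intervalIntegrable_iff_integrableOn_Ioc_of_le zero_le_one] at h1
    have := h1.2
    rw [hasFiniteIntegral_iff_enorm] at this
    refine ne_of_lt (lt_of_le_of_lt (lintegral_mono fun t => ?_) this)
    exact Real.ofReal_le_enorm _
  refine ⟨ENNReal.ofReal (2 * ρ) * volume Q ^ (1 - 1 / p) * I,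
    ENNReal.mul_ne_top (ENNReal.mul_ne_top ENNReal.ofReal_ne_top
      (ENNReal.rpow_ne_top_of_nonneg (by
        rw [sub_nonneg]; exact (div_le_one hp0).2 hp) hQfin)) hIfin, ?_⟩
  intro φ hφ x hx
  have hQm : MeasurableSet Q := measurableSet_closedBall
  calc ∫⁻ y in Q, ∫⁻ t in Ioc (0 : ℝ) 1, φ (x + t • (y - x)) * ‖y - x‖ₑ
      ≤ ∫⁻ y in Q, ∫⁻ t in Ioc (0 : ℝ) 1, φ (x + t • (y - x)) * ENNReal.ofReal (2 * ρ) := by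
        refine setLIntegral_mono' hQm fun y hy => lintegral_mono fun t => ?_
        gcongr
        rw [← ofReal_norm]
        apply ENNReal.ofReal_le_ofReal
        rw [← dist_eq_norm]
        have h1 := mem_closedBall.1 hx
        have h2 := mem_closedBall.1 hy
        linarith [dist_triangle_right y x a]
    _ = ∫⁻ t in Ioc (0 : ℝ) 1, ∫⁻ y in Q, φ (x + t • (y - x)) * ENNReal.ofReal (2 * ρ) := by
        apply lintegral_lintegral_swap
        refine Measurable.aemeasurable (Measurable.mul_const (hφ.comp ?_) _)
        exact Measurable.add measurable_const
          (Measurable.smul measurable_snd (measurable_fst.sub measurable_const))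
    _ ≤ ∫⁻ t in Ioc (0 : ℝ) 1, ENNReal.ofReal (t ^ (-(m / p))) *
          ((∫⁻ z in Q, φ z ^ p) ^ (1 / p) * volume Q ^ (1 - 1 / p) * ENNReal.ofReal (2 * ρ)) := by
        refine setLIntegral_mono' measurableSet_Ioc fun t ht => ?_
        rw [lintegral_mul_const _ (by fun_prop), ← mul_assoc, ← mul_assoc]
        gcongr
        refine (holder_one (volume.restrict Q) (fun y => φ (x + t • (y - x)))
          (by fun_prop) p hp).trans ?_
        rw [Measure.restrict_apply_univ]
        gcongr
        have ht0 := ht.1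
        have h1 : ∫⁻ y in Q, φ (x + t • (y - x)) ^ p ≤
            ENNReal.ofReal (|(t ^ m)⁻¹|) * ∫⁻ z in Q, φ z ^ p := by
          rw [← lintegral_indicator hQm (fun z => φ z ^ p),
            ← lintegral_comp_homothety x t ht.1.ne' _ ((hφ.pow_const p).indicator hQm),
            ← lintegral_indicator hQm]
          refine lintegral_mono fun y => ?_
          by_cases hy : y ∈ Q
          · rw [indicator_of_mem hy, indicator_of_mem (segment_mem_cube hx hy ht)]
          · simp [indicator_of_notMem hy]
        refine (ENNReal.rpow_le_rpow h1 (by positivity)).trans (le_of_eq ?_)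
        rw [ENNReal.mul_rpow_of_nonneg _ _ (by positivity),
          ENNReal.ofReal_rpow_of_nonneg (abs_nonneg _) (by positivity)]
        congr 2
        rw [abs_of_pos (by positivity), ← Real.rpow_natCast, ← Real.rpow_neg ht0.le,
          ← Real.rpow_mul ht0.le]
        congr 1
        ring
    _ = _ := by
        rw [lintegral_mul_const _ (by fun_prop), ← hI]
        ring

lemma lint_fin_one (G : (Fin 1 → ℝ) → ℝ≥0∞) (hGm : Measurable G) :
   ∫⁻ r:ℝ, G (fun _ => r) = ∫⁻ z, G z := by
  have hm : Measurable (fun (r : ℝ) (_ : Fin 1) => r) := measurable_pi_lambda _ fun _ => measurable_id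
  have : Measure.map (fun (r : ℝ) (_ : Fin 1) => r) volume = volume := by
    refine (Measure.pi_eq fun s hs => ?_).symm
    rw [Measure.map_apply hm (MeasurableSet.univ_pi hs)]
    simp [Set.preimage]
  rw [← this, lintegral_map hGm hm]

lemma kernel_bound_one (p : ℝ) (hp : 1 ≤ p) (a : Fin 1 → ℝ) (ρ : ℝ) :
    ∃ C : ℝ≥0∞, C ≠ ∞ ∧ ∀ φ : (Fin 1 → ℝ) → ℝ≥0∞, Measurable φ → ∀ x ∈ closedBall a ρ,
      ∫⁻ y in closedBall a ρ, ∫⁻ t in Ioc (0 : ℝ) 1, φ (x + t • (y - x)) * ‖y - x‖ₑ ≤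
        C * (∫⁻ z in closedBall a ρ, φ z ^ p) ^ (1 / p) := by
  set Q := closedBall a ρ with hQ
  have hp0 : 0 < p := by linarith
  have hQm : MeasurableSet Q := measurableSet_closedBall
  have hQfin : volume Q ≠ ∞ := (isCompact_closedBall a ρ).measure_lt_top.ne
  refine ⟨volume Q ^ (1 - 1 / p) * volume Q, ENNReal.mul_ne_top
      (ENNReal.rpow_ne_top_of_nonneg (by
        rw [sub_nonneg]; exact (div_le_one hp0).2 hp) hQfin) hQfin, ?_⟩
  intro φ hφ x hx
  have hsub : ∀ y ∈ Q, ∫⁻ t in Ioc (0 : ℝ) 1, φ (x + t • (y - x)) * ‖y - x‖ₑ ≤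
      ∫⁻ z in Q, φ z := by
    intro y hy
    rcases eq_or_ne y x with rfl | hne
    · simp
    set s : ℝ := y 0 - x 0 with hs
    have hs0 : s ≠ 0 := by
      intro h
      apply hne
      ext i
      rw [Fin.fin_one_eq_zero i]
      linarith
    have hys : y - x = fun _ => s := by
      ext i; rw [Fin.fin_one_eq_zero i]; rfl
    have hnorm : ‖y - x‖ₑ = ENNReal.ofReal |s| := by
      rw [hys, ← ofReal_norm]; simp
    set G : (Fin 1 → ℝ) → ℝ≥0∞ := Q.indicator φ with hG
    have hGm : Measurable G := hφ.indicator hQm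
    have hGe : ∀ r : ℝ, Measurable fun t : ℝ => G (fun _ => x 0 + t) := fun r =>
      hGm.comp (measurable_pi_lambda _ fun _ => by fun_prop)
    have hxt : ∀ t : ℝ, x + t • (y - x) = fun _ => x 0 + t * s := by
      intro t; ext i; rw [hys, Fin.fin_one_eq_zero i]; simp
    calc ∫⁻ t in Ioc (0 : ℝ) 1, φ (x + t • (y - x)) * ‖y - x‖ₑ
        ≤ ∫⁻ t in Ioc (0 : ℝ) 1, G (fun _ => x 0 + t * s) * ENNReal.ofReal |s| := by
          refine setLIntegral_mono' measurableSet_Ioc fun t ht => ?_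
          rw [hnorm, ← hxt, hG, indicator_of_mem (segment_mem_cube hx hy ht)]
      _ ≤ ∫⁻ t : ℝ, G (fun _ => x 0 + t * s) * ENNReal.ofReal |s| := setLIntegral_le_lintegral _ _
      _ = (∫⁻ t : ℝ, G (fun _ => x 0 + t * s)) * ENNReal.ofReal |s| := by
          rw [lintegral_mul_const]
          exact hGm.comp (measurable_pi_lambda _ fun _ => by fun_prop)
      _ = ∫⁻ r : ℝ, G (fun _ => x 0 + r) := by
          have h1 : ∫⁻ t : ℝ, G (fun _ => x 0 + t * s) =
              ∫⁻ r, G (fun _ => x 0 + r) ∂(Measure.map (· * s) volume) := by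
            rw [lintegral_map (hGe 0) (by fun_prop)]
          rw [h1, Real.map_volume_mul_right hs0, lintegral_smul_measure, smul_eq_mul, mul_comm,
            ← mul_assoc, ← ENNReal.ofReal_mul (abs_nonneg _), abs_inv,
            mul_inv_cancel₀ (abs_ne_zero.2 hs0)]
          simp
      _ = ∫⁻ r : ℝ, G (fun _ => r) := by
          rw [lintegral_add_left_eq_self (fun r : ℝ => G (fun _ => r)) (x 0)]
      _ = ∫⁻ z, G z := by
          exact lint_fin_one G hGm
      _ = ∫⁻ z in Q, φ z := lintegral_indicator hQm _
  calc ∫⁻ y in Q, ∫⁻ t in Ioc (0 : ℝ) 1, φ (x + t • (y - x)) * ‖y - x‖ₑ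
      ≤ ∫⁻ _ in Q, ∫⁻ z in Q, φ z := setLIntegral_mono' hQm hsub
    _ = (∫⁻ z in Q, φ z) * volume Q := by simp
    _ ≤ _ := by
        rw [mul_comm (volume Q ^ (1 - 1 / p)), mul_assoc, mul_comm (volume Q)]
        gcongr
        rw [mul_comm]
        simpa using holder_one (volume.restrict Q) φ hφ.aemeasurable p hp

lemma ftc_bound {m : ℕ} {F : Type*} [NormedAddCommGroup F] [NormedSpace ℝ F] [CompleteSpace F]
    (u : (Fin m → ℝ) → F) (hu : ContDiff ℝ 1 u) (x y : Fin m → ℝ) :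
    ‖u x‖ₑ ≤ ‖u y‖ₑ + ∫⁻ t in Ioc (0 : ℝ) 1, ‖fderiv ℝ u (x + t • (y - x))‖ₑ * ‖y - x‖ₑ := by
  have hcd : Continuous (fderiv ℝ u) := hu.continuous_fderiv (by norm_num)
  have h1 : u y - u x = ∫ t in (0 : ℝ)..1, fderiv ℝ u (x + t • (y - x)) (y - x) := by
    have := intervalIntegral.integral_eq_sub_of_hasDerivAt (a := 0) (b := 1)
      (f := fun t : ℝ => u (x + t • (y - x)))
      (f' := fun t : ℝ => fderiv ℝ u (x + t • (y - x)) (y - x)) ?_ ?_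
    · rw [this]; simp
    · intro t _
      have hl : HasDerivAt (fun t : ℝ => x + t • (y - x)) (y - x) t := by
        simpa using ((hasDerivAt_id t).smul_const (y - x)).const_add x
      exact ((hu.differentiable (by norm_num) _).hasFDerivAt).comp_hasDerivAt t hl
    · exact Continuous.intervalIntegrable (by fun_prop) _ _
  have h2 : ‖u y - u x‖ₑ ≤ ∫⁻ t in Ioc (0 : ℝ) 1, ‖fderiv ℝ u (x + t • (y - x))‖ₑ * ‖y - x‖ₑ := by
    rw [h1, intervalIntegral.integral_of_le zero_le_one]
    refine (enorm_integral_le_lintegral_enorm _).trans (lintegral_mono fun t => ?_)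
    exact ContinuousLinearMap.le_opENorm _ _
  calc ‖u x‖ₑ = ‖u y - (u y - u x)‖ₑ := by rw [sub_sub_cancel]
    _ ≤ ‖u y‖ₑ + ‖u y - u x‖ₑ := enorm_sub_le
    _ ≤ _ := by gcongr

/-- Morrey's inequality on a cube, qualitative smallness form. -/
lemma morrey_small {m : ℕ} (p : ℝ) (hp : 1 ≤ p) (hmp : (m : ℝ) < p ∨ m = 1)
    {F : Type*} [NormedAddCommGroup F] [NormedSpace ℝ F] [CompleteSpace F]
    (a : Fin m → ℝ) (ρ : ℝ) (hρ : 0 < ρ) (δ : ℝ≥0∞) (hδ : 0 < δ) :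
    ∃ η : ℝ≥0∞, 0 < η ∧ ∀ u : (Fin m → ℝ) → F, ContDiff ℝ 1 u →
      ∫⁻ z in closedBall a ρ, (‖u z‖ₑ ^ p + ‖fderiv ℝ u z‖ₑ ^ p) ≤ η →
      ∀ x ∈ closedBall a ρ, ‖u x‖ₑ ≤ δ := by
  have hp0 : 0 < p := by linarith
  obtain ⟨C, hC, hker⟩ : ∃ C : ℝ≥0∞, C ≠ ∞ ∧ ∀ φ : (Fin m → ℝ) → ℝ≥0∞, Measurable φ →
      ∀ x ∈ closedBall a ρ,
      ∫⁻ y in closedBall a ρ, ∫⁻ t in Ioc (0 : ℝ) 1, φ (x + t • (y - x)) * ‖y - x‖ₑ ≤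
        C * (∫⁻ z in closedBall a ρ, φ z ^ p) ^ (1 / p) := by
    rcases hmp with h | rfl
    · exact kernel_bound_gt p hp h a ρ
    · exact kernel_bound_one p hp a ρ
  set Q := closedBall a ρ with hQ
  have hQm : MeasurableSet Q := measurableSet_closedBall
  have hQfin : volume Q ≠ ∞ := (isCompact_closedBall a ρ).measure_lt_top.ne
  have hQ0 : volume Q ≠ 0 := (measure_closedBall_pos volume a hρ).ne'
  set C' := volume Q ^ (1 - 1 / p) + C with hC'
  have hC'fin : C' ≠ ∞ := ENNReal.add_ne_top.2 ⟨ENNReal.rpow_ne_top_of_nonneg (by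
        rw [sub_nonneg]; exact (div_le_one hp0).2 hp) hQfin, hC⟩
  -- choose η
  have hlim : Tendsto (fun η : ℝ≥0∞ => C' * η ^ (1 / p)) (𝓝 0) (𝓝 0) := by
    have h1 : Tendsto (fun η : ℝ≥0∞ => η ^ (1 / p)) (𝓝 0) (𝓝 0) := by
      have := (ENNReal.continuous_rpow_const (y := 1 / p)).tendsto 0
      rwa [ENNReal.zero_rpow_of_pos (by positivity)] at this
    simpa using ENNReal.Tendsto.const_mul h1 (Or.inr hC'fin)
  have hpos : 0 < volume Q * δ := ENNReal.mul_pos hQ0 hδ.ne'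
  obtain ⟨η, hη, hη0⟩ := ((hlim.eventually_lt_const hpos).filter_mono nhdsWithin_le_nhds |>.and
    (self_mem_nhdsWithin : ∀ᶠ η : ℝ≥0∞ in 𝓝[>] 0, η ∈ Ioi 0)).exists
  refine ⟨η, hη0, fun u hu hIntg x hx => ?_⟩
  have hcd : Continuous (fderiv ℝ u) := hu.continuous_fderiv (by norm_num)
  have huc := hu.continuous
  have hA : ∫⁻ z in Q, ‖u z‖ₑ ^ p ≤ η :=
    (lintegral_mono fun z => le_self_add).trans hIntg
  have hB : ∫⁻ z in Q, ‖fderiv ℝ u z‖ₑ ^ p ≤ η :=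
    (lintegral_mono fun z => le_add_self).trans hIntg
  have h1 : ‖u x‖ₑ * volume Q ≤ C' * η ^ (1 / p) := by
    calc ‖u x‖ₑ * volume Q = ∫⁻ _ in Q, ‖u x‖ₑ := by simp
      _ ≤ ∫⁻ y in Q, (‖u y‖ₑ +
          ∫⁻ t in Ioc (0 : ℝ) 1, ‖fderiv ℝ u (x + t • (y - x))‖ₑ * ‖y - x‖ₑ) :=
          lintegral_mono fun y => ftc_bound u hu x y
      _ = (∫⁻ y in Q, ‖u y‖ₑ) + ∫⁻ y in Q,
          ∫⁻ t in Ioc (0 : ℝ) 1, ‖fderiv ℝ u (x + t • (y - x))‖ₑ * ‖y - x‖ₑ := by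
          rw [lintegral_add_left' huc.enorm.measurable.aemeasurable]
      _ ≤ volume Q ^ (1 - 1 / p) * η ^ (1 / p) + C * η ^ (1 / p) := by
          gcongr
          · have := holder_one (volume.restrict Q) (fun y => ‖u y‖ₑ)
              huc.enorm.measurable.aemeasurable p hp
            rw [Measure.restrict_apply_univ, mul_comm] at this
            refine this.trans ?_
            gcongr
          · refine (hker (fun y => ‖fderiv ℝ u y‖ₑ) hcd.enorm.measurable x hx).trans ?_
            gcongr
      _ = _ := by rw [hC', add_mul]
  have h2 := h1.trans hη.le
  rw [mul_comm] at h2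
  exact (ENNReal.mul_le_mul_iff_right hQ0 hQfin).1 h2


/-- insertion of a coordinate -/
def insE {m : ℕ} (i : Fin (m + 1)) (t : ℝ) (z : Fin m → ℝ) : Em (m + 1) :=
  WithLp.toLp 2 (i.insertNth (α := fun _ => ℝ) t z)

/-- linear part of the insertion -/
def insL {m : ℕ} (i : Fin (m + 1)) : (Fin m → ℝ) →L[ℝ] Em (m + 1) :=
  LinearMap.toContinuousLinearMap
    { toFun := fun z => insE i 0 z
      map_add' := by
        intro z w
        ext j
        refine i.succAboveCases ?_ ?_ j
        · simp [insE]
        · intro j; simp [insE]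
      map_smul' := by
        intro c z
        ext j
        refine i.succAboveCases ?_ ?_ j
        · simp [insE]
        · intro j; simp [insE] }

lemma insE_eq {m : ℕ} (i : Fin (m + 1)) (t : ℝ) (z : Fin m → ℝ) :
    insE i t z = insE i t 0 + insL i z := by
  change insE i t z = insE i t 0 + insE i 0 z
  ext j
  refine i.succAboveCases ?_ ?_ j
  · simp [insE]
  · intro j; simp [insE]

lemma lintegral_insE {m : ℕ} (i : Fin (m + 1)) (F : Em (m + 1) → ℝ≥0∞) (hF : Measurable F) :
    ∫⁻ x, F x = ∫⁻ t : ℝ, ∫⁻ z : Fin m → ℝ, F (insE i t z) := by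
  have h1 := (PiLp.volume_preserving_toLp (Fin (m + 1))).lintegral_comp hF
  rw [← h1]
  have hF2 : Measurable fun x : Fin (m + 1) → ℝ => F (WithLp.toLp 2 x) :=
    hF.comp (PiLp.volume_preserving_toLp (Fin (m + 1))).measurable
  have h2 := (volume_preserving_piFinSuccAbove (fun _ : Fin (m + 1) => ℝ) i).symm.lintegral_comp hF2
  rw [← h2]
  exact lintegral_prod _ (hF2.comp (MeasurableEquiv.measurable _)).aemeasurable

/-- closed cube -/
def boxE {n : ℕ} (a : Em n) (ρ : ℝ) : Set (Em n) := {x | ∀ j, |x j - a j| ≤ ρ}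

lemma isClosed_boxE {n : ℕ} (a : Em n) (ρ : ℝ) : IsClosed (boxE a ρ) := by
  have : boxE a ρ = ⋂ j, {x : Em n | |x j - a j| ≤ ρ} := by ext; simp [boxE]
  rw [this]
  exact isClosed_iInter fun j => isClosed_le (by fun_prop) continuous_const

lemma slice_exists {m : ℕ} (p : ℝ) (hp : 1 ≤ p) (hmp : (m : ℝ) < p ∨ m = 1)
    (a : Em (m + 1)) (ρ : ℝ) (hρ : 0 < ρ) (i : Fin (m + 1)) (lo hi : ℝ) (hlh : lo < hi)
    (h1 : a i - ρ ≤ lo) (h2 : hi ≤ a i + ρ) (δ : ℝ) (hδ : 0 < δ) :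
    ∃ η : ℝ≥0∞, 0 < η ∧ ∀ U : Em (m + 1) → Em (m + 1), ContDiff ℝ 1 U →
      ∫⁻ x in boxE a ρ, (‖U x‖ₑ ^ p + ‖fderiv ℝ U x‖ₑ ^ p) ≤ η →
      ∃ t ∈ Icc lo hi, ∀ x ∈ boxE a ρ, x i = t → ‖U x‖ ≤ δ := by
  have hp0 : 0 < p := by linarith
  obtain ⟨η', hη', H⟩ := morrey_small p hp hmp (F := Em (m + 1)) (fun j => a (i.succAbove j)) ρ hρ
    (ENNReal.ofReal δ) (by simpa using hδ)
  set Q := closedBall (fun j => a (i.succAbove j)) ρ with hQ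
  set Λ : ℝ≥0∞ := 1 + ‖insL i‖ₑ ^ p with hΛ
  have hΛfin : Λ ≠ ∞ := by
    rw [hΛ]
    exact ENNReal.add_ne_top.2 ⟨by simp, ENNReal.rpow_ne_top_of_nonneg hp0.le (by simp)⟩
  have hΛ0 : Λ ≠ 0 := by rw [hΛ]; simp
  have hlen : 0 < ENNReal.ofReal (hi - lo) := by simpa using hlh
  set η'' := min η' 1 with hη''
  have hη''0 : 0 < η'' := by rw [hη'']; exact lt_min hη' one_pos
  have hη''fin : η'' ≠ ∞ := by
    rw [hη'']; exact ne_top_of_le_ne_top ENNReal.one_ne_top (min_le_right _ _)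
  set c : ℝ≥0∞ := η'' / Λ with hc
  have hc0 : 0 < c := ENNReal.div_pos hη''0.ne' hΛfin
  have hcfin : c ≠ ∞ := ENNReal.div_ne_top hη''fin hΛ0
  have hcl0 : 0 < c * ENNReal.ofReal (hi - lo) := ENNReal.mul_pos hc0.ne' hlen.ne'
  have hclfin : c * ENNReal.ofReal (hi - lo) ≠ ∞ := ENNReal.mul_ne_top hcfin (by simp)
  refine ⟨c * ENNReal.ofReal (hi - lo) / 2, ENNReal.half_pos hcl0.ne', fun U hU hIntg => ?_⟩
  have hcd : Continuous (fderiv ℝ U) := hU.continuous_fderiv (by norm_num)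
  have huc := hU.continuous
  set G : Em (m + 1) → ℝ≥0∞ := fun x => ‖U x‖ₑ ^ p + ‖fderiv ℝ U x‖ₑ ^ p with hG
  have hGm : Measurable G := (huc.enorm.measurable.pow_const p).add (hcd.enorm.measurable.pow_const p)
  have hbm : MeasurableSet (boxE a ρ) := (isClosed_boxE a ρ).measurableSet
  have hmem : ∀ t ∈ Icc lo hi, ∀ z, insE i t z ∈ boxE a ρ ↔ z ∈ Q := by
    intro t ht z
    rw [hQ, mem_closedBall, dist_pi_le_iff hρ.le]
    constructor
    · intro h j
      have := h (i.succAbove j)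
      simpa [insE, Real.dist_eq] using this
    · intro h j
      refine i.succAboveCases ?_ ?_ j
      · simp only [insE, Fin.insertNth_apply_same]
        rw [abs_le]; constructor <;> linarith [ht.1, ht.2]
      · intro j
        simpa [insE, Real.dist_eq] using h j
  -- find good t
  have hgood : ∃ t ∈ Icc lo hi, ∫⁻ z in Q, G (insE i t z) ≤ c := by
    by_contra hcon
    push Not at hcon
    have : c * ENNReal.ofReal (hi - lo) ≤ c * ENNReal.ofReal (hi - lo) / 2 := by
      calc c * ENNReal.ofReal (hi - lo) = ∫⁻ t in Icc lo hi, c := by simp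
        _ ≤ ∫⁻ t in Icc lo hi, ∫⁻ z, (boxE a ρ).indicator G (insE i t z) := by
            refine setLIntegral_mono' measurableSet_Icc fun t ht => ?_
            refine (hcon t ht).le.trans (le_of_eq ?_)
            rw [← lintegral_indicator measurableSet_closedBall]
            refine lintegral_congr fun z => ?_
            by_cases hz : z ∈ Q
            · rw [indicator_of_mem hz, indicator_of_mem ((hmem t ht z).2 hz)]
            · rw [indicator_of_notMem hz, indicator_of_notMem (fun h => hz ((hmem t ht z).1 h))]
        _ ≤ ∫⁻ t, ∫⁻ z, (boxE a ρ).indicator G (insE i t z) := setLIntegral_le_lintegral _ _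
        _ = ∫⁻ x, (boxE a ρ).indicator G x := (lintegral_insE i _ (hGm.indicator hbm)).symm
        _ = ∫⁻ x in boxE a ρ, G x := lintegral_indicator hbm _
        _ ≤ _ := hIntg
    exact absurd this (not_le.2 (ENNReal.half_lt_self hcl0.ne' hclfin))
  obtain ⟨t, ht, hgt⟩ := hgood
  refine ⟨t, ht, ?_⟩
  have hins : (fun z => insE i t z) = fun z => insE i t 0 + insL i z := by
    ext1 z; exact insE_eq i t z
  have hinsc : ContDiff ℝ 1 (fun z => insE i t z) := by
    rw [hins]; exact contDiff_const.add (insL i).contDiff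
  have hder : ∀ z, HasFDerivAt (fun z => insE i t z) (insL i) z := by
    intro z; rw [hins]; exact (insL i).hasFDerivAt.const_add _
  have hu : ContDiff ℝ 1 (fun z => U (insE i t z)) := hU.comp hinsc
  have hfd : ∀ z, fderiv ℝ (fun z => U (insE i t z)) z =
      (fderiv ℝ U (insE i t z)).comp (insL i) := fun z =>
    (((hU.differentiable (by norm_num)) (insE i t z)).hasFDerivAt.comp z (hder z)).fderiv
  have key := H (fun z => U (insE i t z)) hu ?_
  · intro x hx hxt
    have hxe : x = insE i t (fun j => x (i.succAbove j)) := by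
      ext j
      refine i.succAboveCases ?_ ?_ j
      · simp [insE, hxt]
      · intro j; simp [insE]
    have hz : (fun j => x (i.succAbove j)) ∈ Q := by
      rw [← hmem t ht, ← hxe]; exact hx
    have := key _ hz
    rw [← hxe, ← ofReal_norm] at this
    exact (ENNReal.ofReal_le_ofReal_iff hδ.le).1 this
  · calc ∫⁻ z in Q, (‖U (insE i t z)‖ₑ ^ p + ‖fderiv ℝ (fun z => U (insE i t z)) z‖ₑ ^ p)
        ≤ ∫⁻ z in Q, Λ * G (insE i t z) := by
          refine lintegral_mono fun z => ?_
          rw [hfd, hG, hΛ]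
          simp only
          rw [mul_add]
          gcongr
          · exact le_mul_of_one_le_left (by positivity) le_self_add
          · calc ‖(fderiv ℝ U (insE i t z)).comp (insL i)‖ₑ ^ p
                ≤ (‖insL i‖ₑ * ‖fderiv ℝ U (insE i t z)‖ₑ) ^ p := by
                  gcongr
                  rw [mul_comm]
                  simp only [← ofReal_norm]
                  rw [← ENNReal.ofReal_mul (norm_nonneg _)]
                  exact ENNReal.ofReal_le_ofReal (ContinuousLinearMap.opNorm_comp_le _ _)
              _ = ‖insL i‖ₑ ^ p * ‖fderiv ℝ U (insE i t z)‖ₑ ^ p :=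
                  ENNReal.mul_rpow_of_nonneg _ _ hp0.le
              _ ≤ _ := by gcongr; exact le_add_self
      _ = Λ * ∫⁻ z in Q, G (insE i t z) := lintegral_const_mul _ (hGm.comp hinsc.continuous.measurable)
      _ ≤ Λ * c := by gcongr
      _ = η'' := ENNReal.mul_div_cancel hΛ0 hΛfin
      _ ≤ η' := min_le_left _ _

lemma jensen_one {α : Type*} [MeasurableSpace α] (μ : Measure α) (w N : α → ℝ≥0∞)
    (hw : Measurable w) (hN : Measurable N) (h1 : ∫⁻ x, w x ∂μ = 1) (p : ℝ) (hp : 1 ≤ p) :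
    (∫⁻ x, w x * N x ∂μ) ^ p ≤ ∫⁻ x, w x * N x ^ p ∂μ := by
  have hp0 : 0 < p := by linarith
  have h := holder_one (μ.withDensity w) N hN.aemeasurable p hp
  rw [lintegral_withDensity_eq_lintegral_mul _ hw hN,
    lintegral_withDensity_eq_lintegral_mul _ hw (hN.pow_const p)] at h
  have hu : (μ.withDensity w) univ = 1 := by rw [withDensity_apply _ MeasurableSet.univ]; simpa
  rw [hu, ENNReal.one_rpow, mul_one] at h
  have h2 := ENNReal.rpow_le_rpow h hp0.le
  rw [← ENNReal.rpow_mul, one_div_mul_cancel hp0.ne', ENNReal.rpow_one] at h2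
  exact h2

lemma young_one {n : ℕ} {F : Type*} [NormedAddCommGroup F] [NormedSpace ℝ F] [CompleteSpace F]
    (p : ℝ) (hp : 1 ≤ p) (ψ : Em n → ℝ) (hψ : Continuous ψ) (hψ0 : ∀ x, 0 ≤ ψ x)
    (hψi : Integrable ψ) (hψ1 : ∫ x, ψ x = 1) (q : Em n → F) (hq : AEStronglyMeasurable q volume) :
    ∫⁻ x, ‖∫ y, ψ (x - y) • q y‖ₑ ^ p ≤ ∫⁻ y, ‖q y‖ₑ ^ p := by
  have hp0 : 0 < p := by linarith
  set N := hq.enorm.mk _ with hN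
  have hNm : Measurable N := hq.enorm.measurable_mk
  have hNe : (fun y => ‖q y‖ₑ) =ᵐ[volume] N := hq.enorm.ae_eq_mk
  have hl1 : ∫⁻ y, ENNReal.ofReal (ψ y) = 1 := by
    rw [← ofReal_integral_eq_lintegral_ofReal hψi (Eventually.of_forall hψ0), hψ1]; simp
  have hwm : Measurable fun y => ENNReal.ofReal (ψ y) := hψ.measurable.ennreal_ofReal
  calc ∫⁻ x, ‖∫ y, ψ (x - y) • q y‖ₑ ^ p
      ≤ ∫⁻ x, ∫⁻ y, ENNReal.ofReal (ψ (x - y)) * N y ^ p := by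
        refine lintegral_mono fun x => ?_
        have hx1 : ∫⁻ y, ENNReal.ofReal (ψ (x - y)) = 1 := by
          rw [lintegral_sub_left_eq_self (fun y => ENNReal.ofReal (ψ y)) x, hl1]
        refine le_trans ?_ (jensen_one volume (fun y => ENNReal.ofReal (ψ (x - y))) N
          (hwm.comp (measurable_const.sub measurable_id)) hNm hx1 p hp)
        refine ENNReal.rpow_le_rpow ?_ hp0.le
        refine (enorm_integral_le_lintegral_enorm _).trans (le_of_eq ?_)
        refine lintegral_congr_ae ?_
        filter_upwards [hNe] with y hy
        rw [← hy, enorm_smul, Real.enorm_of_nonneg (hψ0 _)]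
    _ = ∫⁻ y, ∫⁻ x, ENNReal.ofReal (ψ (x - y)) * N y ^ p := by
        rw [lintegral_lintegral_swap]
        refine Measurable.aemeasurable ?_
        exact (hwm.comp (measurable_fst.sub measurable_snd)).mul
          ((hNm.comp measurable_snd).pow_const p)
    _ = ∫⁻ y, N y ^ p := by
        refine lintegral_congr fun y => ?_
        have hm : Measurable fun x => ENNReal.ofReal (ψ (x - y)) :=
          hwm.comp (measurable_id.sub measurable_const)
        rw [lintegral_mul_const _ hm,
          lintegral_sub_right_eq_self (fun y => ENNReal.ofReal (ψ y)) y, hl1, one_mul]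
    _ = ∫⁻ y, ‖q y‖ₑ ^ p := by
        refine lintegral_congr_ae ?_
        filter_upwards [hNe] with y hy
        rw [← hy]

lemma integrable_test_smul {n : ℕ} {F : Type*} [NormedAddCommGroup F] [NormedSpace ℝ F]
    {Ω : Set (Em n)} (φ : Em n → ℝ) (hφ : Continuous φ) (hφc : HasCompactSupport φ)
    (hφΩ : tsupport φ ⊆ Ω) (q : Em n → F) (hq : LocallyIntegrableOn q Ω volume) :
    Integrable (fun x => φ x • q x) volume := by
  have h1 := (hq.integrableOn_compact_subset hφΩ hφc).continuousOn_smul hφ.continuousOn hφc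
  rw [← integrableOn_iff_integrable_of_support_subset (s := tsupport φ)]
  · exact h1
  · intro x hx
    apply subset_tsupport
    intro h
    apply hx
    simp only [h, zero_smul]

lemma locallyIntegrableOn_apply {n : ℕ} {Ω : Set (Em n)} {Df : Em n → Em n →L[ℝ] Em n}
    (h : LocallyIntegrableOn Df Ω volume) (v : Em n) :
    LocallyIntegrableOn (fun x => Df x v) Ω volume := by
  intro x hx
  obtain ⟨s, hs, hi⟩ := h x hx
  exact ⟨s, hs, ((ContinuousLinearMap.apply ℝ (Em n) v).integrable_comp hi)⟩

lemma HasWeakDerivOn.sub' {n : ℕ} {Ω : Set (Em n)} {f g : Em n → Em n}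
    {Df Dg : Em n → Em n →L[ℝ] Em n}
    (hf : HasWeakDerivOn f Df Ω) (hg : HasWeakDerivOn g Dg Ω) :
    HasWeakDerivOn (fun x => f x - g x) (fun x => Df x - Dg x) Ω := by
  refine ⟨hf.1.sub hg.1, hf.2.1.sub hg.2.1, fun φ hφ hc hs v => ?_⟩
  have hd : Continuous fun x => fderiv ℝ φ x v :=
    (hφ.continuous_fderiv (by simp)).clm_apply continuous_const
  have hdc : HasCompactSupport fun x => fderiv ℝ φ x v := hc.fderiv_apply ℝ v
  have hds : tsupport (fun x => fderiv ℝ φ x v) ⊆ Ω := (tsupport_fderiv_apply_subset ℝ v).trans hs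
  have a1 := integrable_test_smul _ hd hdc hds f hf.1
  have a2 := integrable_test_smul _ hd hdc hds g hg.1
  have a3 := integrable_test_smul φ hφ.continuous hc hs _ (locallyIntegrableOn_apply hf.2.1 v)
  have a4 := integrable_test_smul φ hφ.continuous hc hs _ (locallyIntegrableOn_apply hg.2.1 v)
  simp only [smul_sub, sub_apply]
  rw [integral_sub a1.integrableOn a2.integrableOn, integral_sub a3.integrableOn a4.integrableOn,
    hf.2.2 φ hφ hc hs v, hg.2.2 φ hφ hc hs v]
  abel

lemma cutoff_exists {n : ℕ} {F : Type*} [NormedAddCommGroup F] (p : ℝ) (hp0 : 0 < p)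
    (K' : Set (Em n)) (hK'm : MeasurableSet K') (q : Em n → F) (hq : IntegrableOn q K' volume) :
    ∃ q' : Em n → F, Integrable q' volume ∧ (∀ x ∈ K', q' x = q x) ∧ (∀ x ∉ K', q' x = 0) ∧
      ∫⁻ x, ‖q' x‖ₑ ^ p = ∫⁻ x in K', ‖q x‖ₑ ^ p := by
  refine ⟨K'.indicator q, hq.integrable_indicator hK'm, fun x hx => indicator_of_mem hx _,
    fun x hx => indicator_of_notMem hx _, ?_⟩
  rw [← lintegral_indicator hK'm]
  refine lintegral_congr fun x => ?_
  by_cases hx : x ∈ K'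
  · rw [indicator_of_mem hx, indicator_of_mem hx]
  · rw [indicator_of_notMem hx, indicator_of_notMem hx]; simp [hp0]

set_option maxHeartbeats 2000000 in
lemma mollify {n : ℕ} (p : ℝ) (hp : 1 ≤ p) (Ω : Set (Em n)) (h : Em n → Em n)
    (Dh : Em n → Em n →L[ℝ] Em n) (hW : HasWeakDerivOn h Dh Ω) (hc : ContinuousOn h Ω)
    (K K' : Set (Em n)) (hK : IsCompact K) (hK' : IsCompact K') (hKK' : K ⊆ interior K')
    (hKΩ : K' ⊆ Ω) (δ : ℝ) (hδ : 0 < δ) :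
    ∃ U : Em n → Em n, ContDiff ℝ 1 U ∧ (∀ x ∈ K, ‖U x - h x‖ ≤ δ) ∧
      ∫⁻ x in K, (‖U x‖ₑ ^ p + ‖fderiv ℝ U x‖ₑ ^ p) ≤
        (∫⁻ x in K', ‖h x‖ₑ ^ p) + ∫⁻ x in K', ‖Dh x‖ₑ ^ p := by
  have hp0 : 0 < p := by linarith
  obtain ⟨r1, hr1, hr1K⟩ := hK.exists_cthickening_subset_open isOpen_interior hKK'
  have huc := hK'.uniformContinuousOn_of_continuous (hc.mono hKΩ)
  obtain ⟨r2, hr2, hr2K⟩ := Metric.uniformContinuousOn_iff_le.1 huc δ hδ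
  set r := min r1 r2 with hr
  have hr0 : 0 < r := lt_min hr1 hr2
  let φ : ContDiffBump (0 : Em n) := ⟨r / 2, r, by positivity, by linarith⟩
  have hφr : φ.rOut = r := rfl
  set ψ := φ.normed volume with hψ
  have hψs : ContDiff ℝ (⊤ : ℕ∞) ψ := φ.contDiff_normed
  have hψs1 : ContDiff ℝ 1 ψ := φ.contDiff_normed (n := 1)
  have hψc : HasCompactSupport ψ := φ.hasCompactSupport_normed
  have hK'm := hK'.measurableSet
  obtain ⟨h', hh'i, hh'1, hh'0, hh'p⟩ := cutoff_exists p hp0 K' hK'm h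
    (hW.1.integrableOn_compact_subset hKΩ hK')
  obtain ⟨D', hD'i, hD'1, hD'0, hD'p⟩ := cutoff_exists p hp0 K' hK'm Dh
    (hW.2.1.integrableOn_compact_subset hKΩ hK')
  have hball : ∀ x ∈ K, closedBall x r ⊆ interior K' := by
    intro x hx
    refine Subset.trans ?_ hr1K
    refine (closedBall_subset_closedBall (min_le_left _ _)).trans ?_
    exact closedBall_subset_cthickening hx r1
  let U : Em n → Em n := convolution ψ h' (ContinuousLinearMap.lsmul ℝ ℝ) volume
  have hUe : ∀ x, U x = ∫ y, ψ (x - y) • h' y := fun x => by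
    simp only [U]; rw [convolution_eq_swap]; simp
  have hU : ContDiff ℝ 1 U :=
    hψc.contDiff_convolution_left (ContinuousLinearMap.lsmul ℝ ℝ) (n := 1) hψs1
      hh'i.locallyIntegrable
  have hder : ∀ x ∈ K, fderiv ℝ U x = ∫ y, ψ (x - y) • D' y := by
    intro x hx
    have hd := (hψc.hasFDerivAt_convolution_left (ContinuousLinearMap.lsmul ℝ ℝ) hψs1
      hh'i.locallyIntegrable x).fderiv
    have hex := (hψc.fderiv ℝ).convolutionExists_left
      ((ContinuousLinearMap.lsmul ℝ ℝ : ℝ →L[ℝ] Em n →L[ℝ] Em n).precompL (Em n))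
      (hψs1.continuous_fderiv (by norm_num)) hh'i.locallyIntegrable x
    rw [hd]
    ext1 v
    -- test function
    set θ : Em n → ℝ := fun y => ψ (x - y) with hθ
    have hθs : ContDiff ℝ (⊤ : ℕ∞) θ := hψs.comp (contDiff_const.sub contDiff_id)
    have hθsupp : Function.support θ ⊆ closedBall x r := by
      intro y hy
      have : x - y ∈ Function.support ψ := hy
      rw [hψ, φ.support_normed_eq, hφr, mem_ball_zero_iff] at this
      rw [mem_closedBall', dist_eq_norm]; exact this.le
    have hθts : tsupport θ ⊆ closedBall x r := closure_minimal hθsupp isClosed_closedBall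
    have hθc : HasCompactSupport θ := HasCompactSupport.of_support_subset_isCompact (isCompact_closedBall x r) hθsupp
    have hbK' : closedBall x r ⊆ K' := (hball x hx).trans interior_subset
    have hfd : ∀ y, fderiv ℝ θ y v = - fderiv ℝ ψ (x - y) v := by
      intro y
      have h1 : HasFDerivAt (fun y : Em n => x - y) (-(ContinuousLinearMap.id ℝ (Em n))) y := by
        simpa using (hasFDerivAt_id (𝕜 := ℝ) y).const_sub x
      have h2 := ((hψs1.differentiable (by norm_num)) (x - y)).hasFDerivAt.comp y h1
      have h3 : fderiv ℝ θ y = _ := h2.fderiv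
      rw [h3]; simp
    have hw := hW.2.2 θ hθs hθc (hθts.trans (hbK'.trans hKΩ)) v
    have e1 : ∫ y in Ω, fderiv ℝ θ y v • h y = - ∫ y, fderiv ℝ ψ (x - y) v • h' y := by
      rw [setIntegral_eq_integral_of_forall_compl_eq_zero, ← integral_neg]
      · refine integral_congr_ae (Eventually.of_forall fun y => ?_)
        simp only
        by_cases hy : y ∈ K'
        · rw [hfd, hh'1 y hy, neg_smul]
        · have : fderiv ℝ θ y v = 0 := by
            have : fderiv ℝ θ y = 0 := fderiv_of_notMem_tsupport (𝕜 := ℝ) fun h => hy (hbK' (hθts h))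
            rw [this]; rfl
          rw [this, hh'0 y hy]; simp
      · intro y hy
        have : fderiv ℝ θ y = 0 := fderiv_of_notMem_tsupport (𝕜 := ℝ) fun h => hy (hKΩ (hbK' (hθts h)))
        rw [this]; simp
    have hθ0 : ∀ y, y ∉ K' → θ y = 0 := fun y hy => by
      by_contra hne
      exact hy (hbK' (hθsupp hne))
    have e2 : ∫ y in Ω, θ y • Dh y v = ∫ y, θ y • D' y v := by
      rw [setIntegral_eq_integral_of_forall_compl_eq_zero]
      · refine integral_congr_ae (Eventually.of_forall fun y => ?_)
        simp only
        by_cases hy : y ∈ K'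
        · rw [hD'1 y hy]
        · rw [hθ0 y hy]; simp
      · intro y hy
        rw [hθ0 y (fun h => hy (hKΩ h))]; simp
    rw [e1, e2, neg_inj] at hw
    have hintD : Integrable (fun y => θ y • D' y) volume :=
      integrable_test_smul (Ω := univ) θ hθs.continuous hθc (subset_univ _) D'
        (hD'i.locallyIntegrable.locallyIntegrableOn _)
    rw [convolution_eq_swap, ContinuousLinearMap.integral_apply hintD,
      ContinuousLinearMap.integral_apply hex.integrable_swap]
    simpa using hw
  refine ⟨U, hU, ?_, ?_⟩
  · intro x hx
    have hxK' : x ∈ K' := interior_subset (hKK' hx)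
    have := φ.dist_normed_convolution_le (μ := volume) (g := h') (x₀ := x) (ε := δ)
      hh'i.aestronglyMeasurable ?_
    · rw [dist_eq_norm] at this
      have e : h' x = h x := hh'1 x hxK'
      rw [e] at this
      exact this
    · intro y hy
      rw [hφr] at hy
      have hyK' : y ∈ K' := interior_subset (hball x hx (ball_subset_closedBall hy))
      rw [hh'1 y hyK', hh'1 x hxK']
      exact hr2K y hyK' x hxK' ((mem_ball.1 hy).le.trans (min_le_right _ _))
  · rw [lintegral_add_left (hU.continuous.enorm.measurable.pow_const p)]
    refine add_le_add ?_ ?_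
    · rw [← hh'p]
      refine (setLIntegral_le_lintegral _ _).trans ?_
      simp only [hUe]
      exact young_one p hp ψ hψs.continuous φ.nonneg_normed φ.integrable_normed φ.integral_normed
        h' hh'i.aestronglyMeasurable
    · rw [← hD'p]
      rw [setLIntegral_congr_fun (g := fun x => ‖∫ y, ψ (x - y) • D' y‖ₑ ^ p) hK.measurableSet
        (fun x hx => by simp only [hder x hx])]
      refine (setLIntegral_le_lintegral _ _).trans ?_
      exact young_one p hp ψ hψs.continuous φ.nonneg_normed φ.integrable_normed φ.integral_normed
        D' hD'i.aestronglyMeasurable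

lemma boxE_eq {n : ℕ} (a : Em n) {ρ : ℝ} (hρ : 0 ≤ ρ) :
    boxE a ρ = (EuclideanSpace.equiv (Fin n) ℝ).toHomeomorph ⁻¹'
      closedBall (EuclideanSpace.equiv (Fin n) ℝ a) ρ := by
  ext x
  simp only [mem_preimage, mem_closedBall, dist_pi_le_iff hρ]
  rfl

lemma isCompact_boxE {n : ℕ} (a : Em n) {ρ : ℝ} (hρ : 0 ≤ ρ) : IsCompact (boxE a ρ) := by
  rw [boxE_eq a hρ]
  exact (Homeomorph.isCompact_preimage _).2 (isCompact_closedBall _ _)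

lemma isOpen_rect {n : ℕ} (l u : Fin n → ℝ) : IsOpen {x : Em n | ∀ j, l j < x j ∧ x j < u j} := by
  have : {x : Em n | ∀ j, l j < x j ∧ x j < u j} =
      ⋂ j, ({x : Em n | l j < x j} ∩ {x : Em n | x j < u j}) := by ext; simp
  rw [this]
  exact isOpen_iInter_of_finite fun j =>
    (isOpen_lt continuous_const (by fun_prop)).inter (isOpen_lt (by fun_prop) continuous_const)

lemma boxE_subset_interior {n : ℕ} (a : Em n) {ρ ρ' : ℝ} (h : ρ < ρ') :
    boxE a ρ ⊆ interior (boxE a ρ') := by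
  refine Subset.trans ?_ (interior_maximal ?_
    (isOpen_rect (fun j => a j - ρ') (fun j => a j + ρ')))
  · intro x hx j
    have := abs_le.1 (hx j)
    constructor <;> linarith
  · intro x hx j
    have := hx j
    rw [abs_le]
    constructor <;> linarith

lemma exists_boxE_subset {n : ℕ} (a : Em n) {V : Set (Em n)} (hV : V ∈ 𝓝 a) :
    ∃ ρ > 0, boxE a ρ ⊆ V := by
  set e := (EuclideanSpace.equiv (Fin n) ℝ) with he
  have h1 : e.symm ⁻¹' V ∈ 𝓝 (e a) := by
    apply e.symm.continuous.continuousAt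
    simpa using hV
  obtain ⟨ρ, hρ, hsub⟩ := Metric.nhds_basis_closedBall.mem_iff.1 h1
  refine ⟨ρ, hρ, fun x hx => ?_⟩
  rw [boxE_eq a hρ.le] at hx
  have h2 : e.symm (e x) ∈ V := hsub hx
  rwa [e.symm_apply_apply] at h2

lemma local_step {m : ℕ} (p : ℝ) (hp1 : 1 ≤ p) (hmp : (m : ℝ) < p ∨ m = 1)
    (Ω : Set (Em (m + 1))) (hΩo : IsOpen Ω)
    (f : ℕ → Em (m + 1) → Em (m + 1)) (Df : ℕ → Em (m + 1) → Em (m + 1) →L[ℝ] Em (m + 1))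
    (g : Em (m + 1) → Em (m + 1)) (Dg : Em (m + 1) → Em (m + 1) →L[ℝ] Em (m + 1))
    (hf : ∀ k, IsHomeoOnto (f k) Ω)
    (hfW : ∀ k, HasWeakDerivOn (f k) (Df k) Ω)
    (hgW : HasWeakDerivOn g Dg Ω)
    (hgc : ContinuousOn g Ω)
    (hconv : TendstoW1pLocOn p f Df g Dg Ω) (x0 : Em (m + 1)) (hx0 : x0 ∈ Ω) (ε : ℝ) (hε : 0 < ε) :
    ∃ t ∈ 𝓝 x0, ∀ᶠ k in atTop, ∀ y ∈ t, dist (g y) (f k y) < ε := by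
  have hfc : ∀ k, ContinuousOn (f k) Ω := fun k =>
    continuousOn_iff_continuous_domRestrict.2 (hf k).continuous
  have hfi : ∀ k, InjOn (f k) Ω := fun k => injOn_iff_injective.2 (hf k).injective
  have hV : {y | y ∈ Ω ∧ dist (g y) (g x0) < ε / 4} ∈ 𝓝 x0 :=
    Filter.inter_mem (hΩo.mem_nhds hx0)
      ((hgc.continuousAt (hΩo.mem_nhds hx0)).eventually (Metric.ball_mem_nhds _ (by positivity)))
  obtain ⟨ρ, hρ, hρV⟩ := exists_boxE_subset x0 hV
  set R := ρ / 3 with hR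
  have hR0 : 0 < R := by positivity
  have hρR : ρ = 3 * R := by rw [hR]; ring
  set K := boxE x0 (2 * R) with hK
  set K' := boxE x0 ρ with hK'
  have hKc : IsCompact K := isCompact_boxE x0 (by positivity)
  have hK'c : IsCompact K' := isCompact_boxE x0 hρ.le
  have hKK' : K ⊆ interior K' := boxE_subset_interior x0 (by linarith)
  have hK'Ω : K' ⊆ Ω := fun x hx => (hρV hx).1
  have hosc : ∀ y ∈ K, dist (g y) (g x0) < ε / 4 := fun y hy =>
    (hρV (interior_subset (hKK' hy))).2
  have hKΩ : K ⊆ Ω := (hKK'.trans interior_subset).trans hK'Ω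
  have hs1 := fun i => slice_exists p hp1 hmp x0 (2 * R) (by positivity) i (x0 i + R)
    (x0 i + 2 * R) (by linarith) (by linarith) le_rfl (ε / 8) (by positivity)
  have hs2 := fun i => slice_exists p hp1 hmp x0 (2 * R) (by positivity) i (x0 i - 2 * R)
    (x0 i - R) (by linarith) le_rfl (by linarith) (ε / 8) (by positivity)
  choose η1 hη1 H1 using hs1
  choose η2 hη2 H2 using hs2
  have hex : ∃ η : ℝ≥0∞, 0 < η ∧ ∀ i, η ≤ η1 i ∧ η ≤ η2 i := by
    refine ⟨Finset.univ.inf' Finset.univ_nonempty (fun i => min (η1 i) (η2 i)), ?_, fun i => ?_⟩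
    · refine (Finset.lt_inf'_iff _).2 ?_
      exact fun i _ => lt_min (hη1 i) (hη2 i)
    · exact le_min_iff.1 (Finset.inf'_le (fun i => min (η1 i) (η2 i)) (Finset.mem_univ i))
  obtain ⟨η, hη0, hη⟩ := hex
  refine ⟨boxE x0 R, mem_interior_iff_mem_nhds.1
    (boxE_subset_interior x0 hR0 (fun j => by simp)), ?_⟩
  filter_upwards [(hconv K' hK'Ω hK'c).eventually_lt_const hη0] with k hk y hy
  obtain ⟨U, hU, hUd, hUi⟩ := mollify p hp1 Ω _ _ ((hfW k).sub' hgW) ((hfc k).sub hgc) K K' hKc hK'c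
    hKK' hK'Ω (ε / 8) (by positivity)
  have hUη : ∫⁻ x in K, (‖U x‖ₑ ^ p + ‖fderiv ℝ U x‖ₑ ^ p) ≤ η :=
    hUi.trans ((le_lintegral_add _ _).trans hk.le)
  have hT1 := fun i => H1 i U hU (hUη.trans (hη i).1)
  have hT2 := fun i => H2 i U hU (hUη.trans (hη i).2)
  choose tp htp Hp using hT1
  choose tm htm Hm using hT2
  set B : Set (Em (m + 1)) := {x | ∀ j, tm j ≤ x j ∧ x j ≤ tp j} with hB
  have hRB : boxE x0 R ⊆ B := by
    intro x hx j
    have := abs_le.1 (hx j)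
    constructor <;> linarith [(htp j).1, (htm j).2]
  have hBK : B ⊆ K := by
    intro x hx j
    have := hx j
    rw [abs_le]
    constructor <;> linarith [(htp j).2, (htm j).1]
  have hBcl : IsClosed B := by
    have : B = ⋂ j, ({x : Em (m + 1) | tm j ≤ x j} ∩ {x : Em (m + 1) | x j ≤ tp j}) := by
      ext; simp [hB]
    rw [this]
    exact isClosed_iInter fun j =>
      (isClosed_le continuous_const (by fun_prop)).inter (isClosed_le (by fun_prop) continuous_const)
  have hBc : IsCompact B := hKc.of_isClosed_subset hBcl hBK
  have hface : ∀ x ∈ B, x ∉ interior B → ‖f k x - g x‖ ≤ ε / 4 := by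
    intro x hx hxi
    have hj : ∃ j, x j = tm j ∨ x j = tp j := by
      by_contra hcon
      push Not at hcon
      apply hxi
      have hsub : {x : Em (m + 1) | ∀ j, tm j < x j ∧ x j < tp j} ⊆ B :=
        fun z hz j => ⟨(hz j).1.le, (hz j).2.le⟩
      exact interior_maximal hsub (isOpen_rect tm tp)
        (fun j => ⟨lt_of_le_of_ne (hx j).1 (hcon j).1.symm, lt_of_le_of_ne (hx j).2 (hcon j).2⟩)
    have hUx : ‖U x‖ ≤ ε / 8 := by
      obtain ⟨j, hj | hj⟩ := hj
      · exact Hm j x (hBK hx) hj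
      · exact Hp j x (hBK hx) hj
    have h1 := hUd x (hBK hx)
    have h2 : f k x - g x = U x - (U x - (f k x - g x)) := by abel
    rw [h2]
    refine (norm_sub_le _ _).trans ?_
    linarith
  obtain ⟨x, hxB, hxi, hmax⟩ := exists_max_frontier (Nat.succ_pos m) (f k) B hBc ⟨y, hRB hy⟩
    ((hfc k).mono (hBK.trans hKΩ)) ((hfi k).mono (hBK.trans hKΩ)) (g x0)
  have h1 := hmax y (hRB hy)
  have h2 := hface x hxB hxi
  have h3 := hosc x (hBK hxB)
  have h4 := hosc y (hBK (hRB hy))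
  rw [← dist_eq_norm, ← dist_eq_norm] at h1
  rw [← dist_eq_norm] at h2
  have h5 := dist_triangle (f k x) (g x) (g x0)
  have h6 := dist_triangle (g y) (g x0) (f k y)
  rw [dist_comm (g x0) (f k y)] at h6
  linarith

theorem stmt10 {n : ℕ} (hn : 2 ≤ n) (p : ℝ)
    (hp : (3 ≤ n → (n : ℝ) - 1 < p) ∧ (n = 2 → 1 ≤ p))
    (Ω : Set (Em n)) (hΩo : IsOpen Ω) (hΩc : IsConnected Ω) (hΩb : Bornology.IsBounded Ω)
    (f : ℕ → Em n → Em n) (Df : ℕ → Em n → Em n →L[ℝ] Em n)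
    (g : Em n → Em n) (Dg : Em n → Em n →L[ℝ] Em n)
    (hf : ∀ k, IsHomeoOnto (f k) Ω)
    (hfW : ∀ k, HasWeakDerivOn (f k) (Df k) Ω)
    (hgW : HasWeakDerivOn g Dg Ω)
    (hgc : ContinuousOn g Ω)
    (hconv : TendstoW1pLocOn p f Df g Dg Ω) :
    TendstoLocallyUniformlyOn f g atTop Ω := by
  obtain ⟨m, rfl⟩ : ∃ m, n = m + 1 := ⟨n - 1, by omega⟩
  have hcase : 1 ≤ p ∧ ((m : ℝ) < p ∨ m = 1) := by
    rcases Nat.lt_or_ge m 2 with h | h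
    · have hm : m = 1 := by omega
      exact ⟨hp.2 (by omega), Or.inr hm⟩
    · have h1 := hp.1 (by omega)
      have h2 : (2 : ℝ) ≤ m := by exact_mod_cast h
      push_cast at h1
      exact ⟨by linarith, Or.inl (by linarith)⟩
  rw [Metric.tendstoLocallyUniformlyOn_iff]
  intro ε hε x0 hx0
  obtain ⟨t, ht, h⟩ := local_step p hcase.1 hcase.2 Ω hΩo f Df g Dg hf hfW hgW hgc hconv x0 hx0 ε hε
  exact ⟨t, mem_nhdsWithin_of_mem_nhds ht, h⟩
end
end

section
/- Let Ω ⊆ ℝⁿ be a bounded domain and f_k : Ω → ℝⁿ continuous maps converging locally uniformly to f : Ω → ℝⁿ. Assume all f_k and f satisfy the Lusin condition (N) and are a.e. approximately differentiable, that {J_a f_k}_k is uniformly integrable on every compact subset of Ω, and that for every subdomain U compactly contained in Ω with |∂U| = 0, the topological degree deg(f, U, y) is nonzero for a.e. y ∈ f(U). Then for every measurable set E compactly contained in Ω, lim_{k→∞} |f_k(E)| = |f(E)|. -/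
open MeasureTheory Metric Filter Topology Set
open scoped ENNReal NNReal Topology

noncomputable section

variable {n : ℕ}

open scoped Pointwise

lemma aux_dens (S : Set (Em n)) (hS : MeasurableSet S) (x : Em n)
    (h : Tendsto (fun r : ℝ => volume (S ∩ Metric.ball x r) / volume (Metric.ball x r))
      (𝓝[>] (0 : ℝ)) (𝓝 1)) :
    Tendsto (fun r : ℝ => volume (Sᶜ ∩ closedBall x r) / volume (closedBall x r))
      (𝓝[>] (0 : ℝ)) (𝓝 0) := by
  have h1 : Tendsto (fun r : ℝ => 1 - volume (S ∩ Metric.ball x r) / volume (Metric.ball x r))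
      (𝓝[>] (0 : ℝ)) (𝓝 (1 - 1)) :=
    ENNReal.Tendsto.sub tendsto_const_nhds h (Or.inl ENNReal.one_ne_top)
  rw [tsub_self] at h1
  refine h1.congr' ?_
  filter_upwards [self_mem_nhdsWithin] with r hr
  have hr : 0 < r := hr
  have hae : closedBall x r =ᵐ[volume] ball x r := by
    rw [← ball_union_sphere]
    have : sphere x r =ᵐ[volume] (∅ : Set (Em n)) := by
      rw [ae_eq_empty]; exact Measure.addHaar_sphere_of_ne_zero _ x hr.ne'
    simpa using (ae_eq_refl (ball x r)).union this
  have e1 : volume (Sᶜ ∩ closedBall x r) = volume (Sᶜ ∩ ball x r) :=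
    measure_congr ((ae_eq_refl _).inter hae)
  rw [e1, measure_congr hae]
  have hp : volume (ball x r) ≠ 0 := (measure_ball_pos _ _ hr).ne'
  have hf : volume (ball x r) ≠ ∞ := measure_ball_lt_top.ne
  have e2 : volume (Sᶜ ∩ ball x r) = volume (ball x r) - volume (S ∩ ball x r) := by
    have := measure_inter_add_sdiff (μ := volume) (ball x r) hS
    rw [← this, inter_comm S]
    rw [ENNReal.add_sub_cancel_left (measure_ne_top_of_subset inter_subset_left hf)]
    congr 1
    ext y; simp [and_comm]
  rw [e2, ENNReal.sub_div (by intros; exact hp), ENNReal.div_self hp hf]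

/-- Uniqueness of derivatives along a set with density one. -/
lemma aux_unique (f : Em n → Em n) (L A : Em n →L[ℝ] Em n) (x : Em n) (C S : Set (Em n))
    (hC : Tendsto (fun r : ℝ => volume (Cᶜ ∩ closedBall x r) / volume (closedBall x r))
      (𝓝[>] (0 : ℝ)) (𝓝 0))
    (hS : Tendsto (fun r : ℝ => volume (Sᶜ ∩ closedBall x r) / volume (closedBall x r))
      (𝓝[>] (0 : ℝ)) (𝓝 0))
    (hL : ∀ ε : ℝ, 0 < ε → ∀ᶠ y in 𝓝[S] x, ‖f y - f x - L (y - x)‖ ≤ ε * ‖y - x‖)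
    (hA : HasFDerivWithinAt f A C x) : A = L := by
  suffices H : ∀ z, ∀ ε, 0 < ε → ‖(A - L) z‖ ≤ (ε + ε) * (‖z‖ + ε) + ‖A - L‖ * ε by
    rw [← sub_eq_zero]
    ext1 z
    have : Tendsto (fun ε : ℝ => (ε + ε) * (‖z‖ + ε) + ‖A - L‖ * ε) (𝓝[>] 0)
        (𝓝 ((0 + 0) * (‖z‖ + 0) + ‖A - L‖ * 0)) :=
      Tendsto.mono_left (Continuous.tendsto (by fun_prop) 0) nhdsWithin_le_nhds
    simp only [add_zero, mul_zero, zero_mul] at this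
    have h0 : ‖(A - L) z‖ ≤ 0 := by
      apply le_of_tendsto_of_tendsto tendsto_const_nhds this
      filter_upwards [self_mem_nhdsWithin]
      exact H z
    simpa using h0
  intro z ε εpos
  have htt : volume (closedBall z ε) ≠ 0 := (measure_closedBall_pos _ z εpos).ne'
  have htf : volume (closedBall z ε) ≠ ∞ := measure_closedBall_lt_top.ne
  have B₁ : ∀ᶠ r in 𝓝[>] (0 : ℝ), ((S ∩ C) ∩ ({x} + r • closedBall z ε)).Nonempty := by
    have c1 := Measure.tendsto_addHaar_inter_smul_zero_of_density_zero volume _ x hC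
      (closedBall z ε) measurableSet_closedBall htf
    have c2 := Measure.tendsto_addHaar_inter_smul_zero_of_density_zero volume _ x hS
      (closedBall z ε) measurableSet_closedBall htf
    have c3 := c1.add c2
    rw [add_zero] at c3
    filter_upwards [(tendsto_order.1 c3).2 1 one_pos, self_mem_nhdsWithin] with r hr rpos
    have rpos : 0 < r := rpos
    by_contra hne
    rw [not_nonempty_iff_eq_empty] at hne
    set T := ({x} + r • closedBall z ε) with hT
    have hT0 : volume T ≠ 0 := by
      simp [hT, Measure.addHaar_smul, htt, rpos.ne']
    have hTf : volume T ≠ ∞ := by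
      simp only [hT, Measure.addHaar_smul, image_add_left, singleton_add, measure_preimage_add]
      exact ENNReal.mul_ne_top ENNReal.ofReal_ne_top htf
    have hsub : T ⊆ (Cᶜ ∩ T) ∪ (Sᶜ ∩ T) := by
      intro y hy
      by_contra hcon
      have : y ∈ (S ∩ C) ∩ T := by
        simp only [mem_union, mem_inter_iff, mem_compl_iff, not_or, not_and] at hcon ⊢
        tauto
      rw [hne] at this
      exact this
    have : volume T ≤ volume (Cᶜ ∩ T) + volume (Sᶜ ∩ T) :=
      (measure_mono hsub).trans (measure_union_le _ _)
    rw [← ENNReal.add_div, ENNReal.div_lt_iff (Or.inl hT0) (Or.inl hTf), one_mul] at hr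
    exact absurd this (not_le.2 hr)
  obtain ⟨ρ, ρpos, hρ⟩ :
    ∃ ρ > 0, ball x ρ ∩ C ⊆ {y : Em n | ‖f y - f x - A (y - x)‖ ≤ ε * ‖y - x‖} :=
    mem_nhdsWithin_iff.1 (hA.isLittleO.def εpos)
  obtain ⟨ρ', ρpos', hρ'⟩ :
    ∃ ρ > 0, ball x ρ ∩ S ⊆ {y : Em n | ‖f y - f x - L (y - x)‖ ≤ ε * ‖y - x‖} :=
    mem_nhdsWithin_iff.1 (hL ε εpos)
  have B₂ : ∀ᶠ r in 𝓝[>] (0 : ℝ), {x} + r • closedBall z ε ⊆ ball x ρ := by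
    apply nhdsWithin_le_nhds
    exact eventually_singleton_add_smul_subset isBounded_closedBall (ball_mem_nhds x ρpos)
  have B₃ : ∀ᶠ r in 𝓝[>] (0 : ℝ), {x} + r • closedBall z ε ⊆ ball x ρ' := by
    apply nhdsWithin_le_nhds
    exact eventually_singleton_add_smul_subset isBounded_closedBall (ball_mem_nhds x ρpos')
  obtain ⟨r, ⟨y, ⟨⟨yS, yC⟩, hy⟩⟩, rρ, rρ', rpos⟩ :
    ∃ r : ℝ,
      ((S ∩ C) ∩ ({x} + r • closedBall z ε)).Nonempty ∧ {x} + r • closedBall z ε ⊆ ball x ρ ∧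
        {x} + r • closedBall z ε ⊆ ball x ρ' ∧ 0 < r :=
    (B₁.and (B₂.and (B₃.and self_mem_nhdsWithin))).exists
  obtain ⟨a, az, ya⟩ : ∃ a, a ∈ closedBall z ε ∧ y = x + r • a := by
    simp only [mem_smul_set, image_add_left, mem_preimage, singleton_add] at hy
    rcases hy with ⟨a, az, ha⟩
    exact ⟨a, az, by simp only [ha, add_neg_cancel_left]⟩
  have norm_a : ‖a‖ ≤ ‖z‖ + ε :=
    calc
      ‖a‖ = ‖z + (a - z)‖ := by simp only [add_sub_cancel]
      _ ≤ ‖z‖ + ‖a - z‖ := norm_add_le _ _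
      _ ≤ ‖z‖ + ε := by grw [mem_closedBall_iff_norm.1 az]
  have I : r * ‖(A - L) a‖ ≤ r * (ε + ε) * (‖z‖ + ε) :=
    calc
      r * ‖(A - L) a‖ = ‖(A - L) (r • a)‖ := by
        simp only [map_smul, norm_smul, Real.norm_eq_abs, abs_of_nonneg rpos.le]
      _ = ‖f y - f x - L (y - x) - (f y - f x - A (y - x))‖ := by
        simp only [ya, add_sub_cancel_left, sub_sub_sub_cancel_left, FunLike.coe_sub,
          Pi.sub_apply, map_smul, smul_sub]
      _ ≤ ‖f y - f x - L (y - x)‖ + ‖f y - f x - A (y - x)‖ := norm_sub_le _ _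
      _ ≤ ε * ‖y - x‖ + ε * ‖y - x‖ := (add_le_add (hρ' ⟨rρ' hy, yS⟩) (hρ ⟨rρ hy, yC⟩))
      _ = r * (ε + ε) * ‖a‖ := by
        simp only [ya, add_sub_cancel_left, norm_smul, Real.norm_eq_abs, abs_of_nonneg rpos.le]
        ring
      _ ≤ r * (ε + ε) * (‖z‖ + ε) := by gcongr
  calc
    ‖(A - L) z‖ = ‖(A - L) a + (A - L) (z - a)‖ := by
      congr 1
      simp only [FunLike.coe_sub, map_sub, Pi.sub_apply]
      abel
    _ ≤ ‖(A - L) a‖ + ‖(A - L) (z - a)‖ := norm_add_le _ _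
    _ ≤ (ε + ε) * (‖z‖ + ε) + ‖A - L‖ * ‖z - a‖ := by
      apply add_le_add
      · rw [mul_assoc] at I; exact (mul_le_mul_iff_right₀ rpos).1 I
      · apply ContinuousLinearMap.le_opNorm
    _ ≤ (ε + ε) * (‖z‖ + ε) + ‖A - L‖ * ε := by
      rw [mem_closedBall_iff_norm'] at az
      gcongr

lemma aux_approx (f : Em n → Em n) (L : Em n →L[ℝ] Em n) (x : Em n)
    (h : HasApproxDerivAt f L x) : ∃ S : Set (Em n),
      Tendsto (fun r : ℝ => volume (Sᶜ ∩ closedBall x r) / volume (closedBall x r))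
        (𝓝[>] (0 : ℝ)) (𝓝 0) ∧
      ∀ ε : ℝ, 0 < ε → ∀ᶠ y in 𝓝[S] x, ‖f y - f x - L (y - x)‖ ≤ ε * ‖y - x‖ := by
  obtain ⟨S, hSm, hS, hL⟩ := h
  refine ⟨S, aux_dens S hSm x hS, fun ε hε => ?_⟩
  have := (tendsto_order.1 hL).2 ε hε
  rw [eventually_nhdsWithin_iff] at this ⊢
  filter_upwards [this] with y hy hyS
  by_cases hyx : y = x
  · simp [hyx]
  · have := hy ⟨hyS, hyx⟩
    have hpos : 0 < ‖y - x‖ := norm_pos_iff.2 (sub_ne_zero.2 hyx)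
    rw [div_lt_iff₀ hpos] at this
    exact this.le

def badSet (f : Em n → Em n) (j : ℕ) (x : Em n) : Set (Em n) :=
  {y | (j : ℝ) * ‖y - x‖ < ‖f y - f x‖}

def goodPts (f : Em n → Em n) (j : ℕ) : Set (Em n) :=
  {x | ∀ r : ℝ, 0 < r → r < 1 / ((j : ℝ) + 1) →
    volume (badSet f j x ∩ closedBall x r) < volume (closedBall (0 : Em n) (r / 2)) / 2}

lemma aux_good (f : Em n → Em n) (L : Em n →L[ℝ] Em n) (x : Em n)
    (h : HasApproxDerivAt f L x) : ∃ j, x ∈ goodPts f j := by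
  obtain ⟨S, hS, hL⟩ := aux_approx f L x h
  obtain ⟨ρ, ρpos, hρ⟩ :
    ∃ ρ > 0, ball x ρ ∩ S ⊆ {y : Em n | ‖f y - f x - L (y - x)‖ ≤ 1 * ‖y - x‖} :=
    mem_nhdsWithin_iff.1 (hL 1 one_pos)
  set c : ℝ≥0∞ := ENNReal.ofReal ((1 / 2 : ℝ) ^ (Module.finrank ℝ (Em n))) / 2 with hc
  have hcpos : 0 < c := by
    rw [hc]
    apply ENNReal.half_pos
    simp
  have h2 := (tendsto_order.1 hS).2 c hcpos
  obtain ⟨δ, δpos, hδ⟩ := mem_nhdsGT_iff_exists_Ioo_subset.1 h2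
  have δpos : 0 < δ := δpos
  obtain ⟨j, hj⟩ := exists_nat_gt (max (‖L‖ + 1) (max (1 / ρ) (1 / δ)))
  have hj1 : ‖L‖ + 1 < j := (le_max_left _ _).trans_lt hj
  have hj2 : 1 / ρ < j := ((le_max_left _ _).trans (le_max_right _ _)).trans_lt hj
  have hj3 : 1 / δ < j := ((le_max_right _ _).trans (le_max_right _ _)).trans_lt hj
  have hjp : (0 : ℝ) < (j : ℝ) + 1 := by positivity
  refine ⟨j, fun r hr hrj => ?_⟩
  have hrρ : r < ρ := hrj.trans (by
    rw [div_lt_comm₀ hjp ρpos]; linarith)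
  have hrδ : r < δ := hrj.trans (by
    rw [div_lt_comm₀ hjp δpos]; linarith)
  have h3 : volume (Sᶜ ∩ closedBall x r) / volume (closedBall x r) < c := hδ ⟨hr, hrδ⟩
  have hp : volume (closedBall x r) ≠ 0 := (measure_closedBall_pos _ _ hr).ne'
  have hf : volume (closedBall x r) ≠ ∞ := measure_closedBall_lt_top.ne
  rw [ENNReal.div_lt_iff (Or.inl hp) (Or.inl hf)] at h3
  have hsub : badSet f j x ∩ closedBall x r ⊆ Sᶜ ∩ closedBall x r := by
    rintro y ⟨hy, hyr⟩
    refine ⟨fun hyS => ?_, hyr⟩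
    have h4 : ‖f y - f x - L (y - x)‖ ≤ 1 * ‖y - x‖ :=
      hρ ⟨mem_ball.2 ((mem_closedBall.1 hyr).trans_lt hrρ), hyS⟩
    have h5 : (j : ℝ) * ‖y - x‖ < ‖f y - f x‖ := hy
    have h6 : ‖f y - f x‖ ≤ ‖f y - f x - L (y - x)‖ + ‖L (y - x)‖ := by
      simpa using norm_add_le (f y - f x - L (y - x)) (L (y - x))
    have h7 := L.le_opNorm (y - x)
    have h8 : (‖L‖ + 1) * ‖y - x‖ ≤ j * ‖y - x‖ := by gcongr
    linarith
  refine (measure_mono hsub).trans_lt (h3.trans_le (le_of_eq ?_))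
  have e : r / 2 = (1 / 2) * r := by ring
  rw [e, Measure.addHaar_closedBall_mul_of_pos _ _ (by norm_num), hc,
    Measure.addHaar_closedBall_center, ENNReal.div_eq_inv_mul, ENNReal.div_eq_inv_mul, mul_assoc]

lemma aux_lip (f : Em n → Em n) (j : ℕ) (x z : Em n) (hx : x ∈ goodPts f j) (hz : z ∈ goodPts f j)
    (hxz : ‖x - z‖ < 1 / ((j : ℝ) + 1)) : ‖f x - f z‖ ≤ 2 * j * ‖x - z‖ := by
  by_cases hne : x = z
  · simp [hne]
  set r := ‖x - z‖ with hr
  have hrpos : 0 < r := norm_pos_iff.2 (sub_ne_zero.2 hne)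
  have h1 := hx r hrpos hxz
  have h2 := hz r hrpos hxz
  set m : Em n := midpoint ℝ x z with hm
  have hmx : dist m x = r / 2 := by
    rw [hm, dist_midpoint_left, dist_eq_norm, ← hr]; norm_num; ring
  have hmz : dist m z = r / 2 := by
    rw [hm, dist_midpoint_right, dist_eq_norm, ← hr]; norm_num; ring
  have hy : ∃ y ∈ closedBall m (r / 2), y ∉ badSet f j x ∧ y ∉ badSet f j z := by
    by_contra hcon
    push Not at hcon
    have hsub : closedBall m (r / 2) ⊆
        (badSet f j x ∩ closedBall x r) ∪ (badSet f j z ∩ closedBall z r) := by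
      intro y hy
      have hyx : y ∈ closedBall x r := by
        rw [mem_closedBall] at hy ⊢
        linarith [dist_triangle y m x]
      have hyz : y ∈ closedBall z r := by
        rw [mem_closedBall] at hy ⊢
        linarith [dist_triangle y m z]
      by_cases hb : y ∈ badSet f j x
      · exact Or.inl ⟨hb, hyx⟩
      · exact Or.inr ⟨hcon y hy hb, hyz⟩
    have h3 := (measure_mono (μ := volume) hsub).trans (measure_union_le _ _)
    have h4 := h3.trans_lt (ENNReal.add_lt_add h1 h2)
    rw [ENNReal.add_halves, Measure.addHaar_closedBall_center] at h4
    exact lt_irrefl _ h4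
  obtain ⟨y, hy, hyx, hyz⟩ := hy
  have hyx : ‖f y - f x‖ ≤ j * ‖y - x‖ := not_lt.1 hyx
  have hyz : ‖f y - f z‖ ≤ j * ‖y - z‖ := not_lt.1 hyz
  rw [mem_closedBall] at hy
  have d1 : ‖y - x‖ ≤ r := by
    rw [← dist_eq_norm]; linarith [dist_triangle y m x]
  have d2 : ‖y - z‖ ≤ r := by
    rw [← dist_eq_norm]; linarith [dist_triangle y m z]
  have d3 : (j : ℝ) * ‖y - x‖ ≤ j * r := by gcongr
  have d4 : (j : ℝ) * ‖y - z‖ ≤ j * r := by gcongr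
  have d5 : ‖f x - f z‖ ≤ ‖f y - f x‖ + ‖f y - f z‖ := by
    have := norm_sub_le (f y - f z) (f y - f x)
    rw [sub_sub_sub_cancel_left] at this
    linarith
  linarith

lemma lip_cover (Ω : Set (Em n)) (hΩo : IsOpen Ω) (f : Em n → Em n) (Df : Em n → Em n →L[ℝ] Em n)
    (hfc : ContinuousOn f Ω) :
    ∃ C : ℕ → Set (Em n), (∀ m, IsClosed (C m)) ∧ (∀ m, C m ⊆ Ω) ∧
      (∀ m, ∃ K, LipschitzOnWith K f (C m)) ∧
      ∀ x ∈ Ω, HasApproxDerivAt f (Df x) x → x ∈ ⋃ m, C m := by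
  classical
  have hex : ∀ j : ℕ, ∀ x ∈ Ω, ∃ s > 0, closedBall x s ⊆ Ω ∧ 2 * s < 1 / ((j : ℝ) + 1) := by
    intro j x hx
    obtain ⟨s, hs, hsub⟩ := Metric.nhds_basis_closedBall.mem_iff.1 (hΩo.mem_nhds hx)
    have hjp : (0 : ℝ) < 1 / ((j : ℝ) + 1) := by positivity
    refine ⟨min s (1 / ((j : ℝ) + 1) / 4), lt_min hs (by positivity),
      (closedBall_subset_closedBall (min_le_left _ _)).trans hsub, ?_⟩
    have := min_le_right s (1 / ((j : ℝ) + 1) / 4)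
    linarith
  choose! s hs hsub hsj using hex
  have hcov : ∀ j, ∃ t ⊆ Ω, t.Countable ∧ Ω ⊆ ⋃ x ∈ t, closedBall x (s j x) := fun j =>
    TopologicalSpace.countable_cover_nhdsWithin fun x hx =>
      mem_nhdsWithin_of_mem_nhds (closedBall_mem_nhds x (hs j x hx))
  choose t htΩ htc ht using hcov
  set 𝒞 : Set (Set (Em n)) :=
    insert ∅ (⋃ j, (fun x => closure (goodPts f j ∩ closedBall x (s j x))) '' t j) with h𝒞
  have hcount : 𝒞.Countable :=
    (countable_iUnion fun j => (htc j).image _).insert _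
  obtain ⟨C, hC⟩ := hcount.exists_eq_range ⟨∅, mem_insert _ _⟩
  have hall : ∀ c ∈ 𝒞, IsClosed c ∧ c ⊆ Ω ∧ ∃ K, LipschitzOnWith K f c := by
    intro c hc
    rcases hc with rfl | hc
    · exact ⟨isClosed_empty, empty_subset _, 0, by simp⟩
    · obtain ⟨j, hj⟩ := mem_iUnion.1 hc
      obtain ⟨x, hx, rfl⟩ := hj
      have hcl : closure (goodPts f j ∩ closedBall x (s j x)) ⊆ Ω :=
        (closure_minimal inter_subset_right isClosed_closedBall).trans (hsub j x (htΩ j hx))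
      refine ⟨isClosed_closure, hcl, 2 * j, ?_⟩
      apply LipschitzOnWith.closure (hfc.mono hcl)
      refine LipschitzOnWith.of_dist_le_mul ?_
      rintro y ⟨hy, hyb⟩ z ⟨hz, hzb⟩
      rw [dist_eq_norm, dist_eq_norm]
      push_cast
      refine aux_lip f j y z hy hz ?_
      rw [← dist_eq_norm]
      have := dist_triangle_right y z x
      have := hsj j x (htΩ j hx)
      rw [mem_closedBall] at hyb hzb
      linarith
  have hmem : ∀ m, C m ∈ 𝒞 := fun m => by rw [hC]; exact mem_range_self m
  refine ⟨C, fun m => (hall _ (hmem m)).1, fun m => (hall _ (hmem m)).2.1,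
    fun m => (hall _ (hmem m)).2.2, fun x hx hd => ?_⟩
  obtain ⟨j, hj⟩ := aux_good f _ x hd
  obtain ⟨q, hq, hxq⟩ := mem_iUnion₂.1 (ht j hx)
  have : closure (goodPts f j ∩ closedBall q (s j q)) ∈ 𝒞 :=
    mem_insert_of_mem _ (mem_iUnion.2 ⟨j, mem_image_of_mem _ hq⟩)
  rw [hC] at this
  obtain ⟨m, hm⟩ := this
  refine mem_iUnion.2 ⟨m, ?_⟩
  rw [hm]
  exact subset_closure ⟨hj, hxq⟩

lemma area_le (Ω : Set (Em n)) (hΩo : IsOpen Ω) (f : Em n → Em n) (Df : Em n → Em n →L[ℝ] Em n)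
    (hfc : ContinuousOn f Ω) (hfN : LusinN f Ω)
    (hfd : ∀ᵐ x ∂(volume.restrict Ω), HasApproxDerivAt f (Df x) x)
    (A : Set (Em n)) (hAΩ : A ⊆ Ω) (hA : MeasurableSet A) :
    volume (f '' A) ≤ ∫⁻ x in A, ENNReal.ofReal |(Df x).det| := by
  obtain ⟨C, hCc, hCΩ, hCl, hCcov⟩ := lip_cover Ω hΩo f Df hfc
  rw [ae_restrict_iff' hΩo.measurableSet] at hfd
  have hder : ∀ m, ∀ᵐ x ∂(volume : Measure (Em n)), x ∈ C m →
      HasFDerivWithinAt f (Df x) (C m) x := by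
    intro m
    obtain ⟨K, hK⟩ := hCl m
    filter_upwards [hK.ae_differentiableWithinAt_of_mem (μ := volume), hfd,
      Besicovitch.ae_tendsto_measure_inter_div_of_measurableSet volume
        (hCc m).measurableSet.compl] with x h1 h2 h3 hx
    have h4 := (h1 hx).hasFDerivWithinAt
    obtain ⟨S, hS, hL⟩ := aux_approx f _ x (h2 (hCΩ m hx))
    rw [indicator_of_notMem (by simpa using hx)] at h3
    rw [← aux_unique f (Df x) _ x (C m) S h3 hS hL h4]
    exact h4
  have hae : ∀ᵐ x ∂(volume : Measure (Em n)), (x ∈ Ω → HasApproxDerivAt f (Df x) x) ∧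
      ∀ m, x ∈ C m → HasFDerivWithinAt f (Df x) (C m) x := hfd.and (ae_all_iff.2 hder)
  obtain ⟨N, hNsub, hNm, hN0⟩ := exists_measurable_superset_of_null (ae_iff.1 hae)
  have hgood : ∀ x ∉ N, (x ∈ Ω → HasApproxDerivAt f (Df x) x) ∧
      ∀ m, x ∈ C m → HasFDerivWithinAt f (Df x) (C m) x := by
    intro x hx
    by_contra h
    exact hx (hNsub h)
  set D : ℕ → Set (Em n) := fun m => (A \ N) ∩ disjointed C m with hD
  have hDm : ∀ m, MeasurableSet (D m) := fun m =>
    (hA.diff hNm).inter (MeasurableSet.disjointed (fun i => (hCc i).measurableSet) m)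
  have hDd : Pairwise (Function.onFun Disjoint D) := fun i j hij =>
    ((disjoint_disjointed C) hij).mono inter_subset_right inter_subset_right
  have hDU : ⋃ m, D m = A \ N := by
    rw [hD, ← inter_iUnion, iUnion_disjointed, inter_eq_left]
    intro x hx
    exact hCcov x (hAΩ hx.1) ((hgood x hx.2).1 (hAΩ hx.1))
  have hsub : f '' A ⊆ f '' (A ∩ N) ∪ ⋃ m, f '' D m := by
    rw [← image_iUnion, hDU, ← image_union, inter_union_sdiff]
  calc volume (f '' A) ≤ volume (f '' (A ∩ N)) + volume (⋃ m, f '' D m) :=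
        (measure_mono hsub).trans (measure_union_le _ _)
    _ = volume (⋃ m, f '' D m) := by
        rw [hfN _ (inter_subset_left.trans hAΩ) (measure_mono_null inter_subset_right hN0),
          zero_add]
    _ ≤ ∑' m, volume (f '' D m) := measure_iUnion_le _
    _ ≤ ∑' m, ∫⁻ x in D m, ENNReal.ofReal |(Df x).det| := by
        refine ENNReal.tsum_le_tsum fun m => ?_
        refine addHaar_image_le_lintegral_abs_det_fderiv volume (hDm m) fun x hx => ?_
        exact ((hgood x hx.1.2).2 m (disjointed_subset C m hx.2)).mono
          (inter_subset_right.trans (disjointed_subset C m))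
    _ = ∫⁻ x in ⋃ m, D m, ENNReal.ofReal |(Df x).det| := (lintegral_iUnion hDm hDd _).symm
    _ ≤ ∫⁻ x in A, ENNReal.ofReal |(Df x).det| := by
        rw [hDU]; exact lintegral_mono_set sdiff_subset

lemma aux_upper (f : ℕ → Em n → Em n) (g : Em n → Em n) (K : Set (Em n)) (hK : IsCompact K)
    (hgc : ContinuousOn g K) (hu : TendstoUniformlyOn f g atTop K) :
    limsup (fun k => volume (f k '' K)) atTop ≤ volume (g '' K) := by
  have hgK : IsCompact (g '' K) := hK.image_of_continuousOn hgc
  have h1 : Tendsto (fun r : ℝ => volume (cthickening r (g '' K))) (𝓝[>] 0)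
      (𝓝 (volume (g '' K))) :=
    (tendsto_measure_cthickening_of_isCompact hgK).mono_left nhdsWithin_le_nhds
  refine ge_of_tendsto h1 ?_
  filter_upwards [self_mem_nhdsWithin] with r hr
  have hr : 0 < r := hr
  refine limsup_le_of_le (by isBoundedDefault) ?_
  filter_upwards [Metric.tendstoUniformlyOn_iff.1 hu r hr] with k hk
  apply measure_mono
  rintro _ ⟨x, hx, rfl⟩
  refine mem_cthickening_of_dist_le _ (g x) _ _ (mem_image_of_mem _ hx) ?_
  rw [dist_comm]
  exact (hk x hx).le

lemma aux_lower (hn : 0 < n) (Ω : Set (Em n))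
    (deg : (Em n → Em n) → Set (Em n) → Em n → ℤ)
    (hdeg_sol : ∀ (h : Em n → Em n) (U : Set (Em n)) (y : Em n),
      IsOpen U → Bornology.IsBounded U → ContinuousOn h (closure U) →
      y ∉ h '' frontier U → deg h U y ≠ 0 → y ∈ h '' U)
    (hdeg_stab : ∀ (h₁ h₂ : Em n → Em n) (U : Set (Em n)) (y : Em n),
      IsOpen U → Bornology.IsBounded U →
      ContinuousOn h₁ (closure U) → ContinuousOn h₂ (closure U) →
      y ∉ h₁ '' frontier U →
      (∀ x ∈ U, ‖h₂ x - h₁ x‖ < Metric.infDist y (h₁ '' frontier U) / Real.sqrt n) →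
      deg h₂ U y = deg h₁ U y)
    (f : ℕ → Em n → Em n) (g : Em n → Em n)
    (hfc : ∀ k, ContinuousOn (f k) Ω) (hgc : ContinuousOn g Ω)
    (hunif : ∀ K, K ⊆ Ω → IsCompact K → TendstoUniformlyOn f g atTop K)
    (hgN : LusinN g Ω)
    (hdegg : ∀ U : Set (Em n), IsOpen U → IsConnected U → closure U ⊆ Ω →
      volume (frontier U) = 0 →
      ∀ᵐ y ∂(volume.restrict (g '' U)), deg g U y ≠ 0)
    (V : Set (Em n)) (hVΩ : V ⊆ Ω) (hV : IsOpen V) :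
    volume (g '' V) ≤ liminf (fun k => volume (f k '' V)) atTop := by
  have : Nonempty (Fin n) := ⟨⟨0, hn⟩⟩
  have : Nontrivial (Em n) := inferInstance
  -- eventual membership for a single ball
  have key : ∀ (c : Em n) (r : ℝ), 0 < r → closedBall c r ⊆ Ω → ∃ Z : Set (Em n), volume Z = 0 ∧
      ∀ y ∈ g '' ball c r, y ∉ Z → ∀ᶠ k in atTop, y ∈ f k '' ball c r := by
    intro c r hr hsub
    have hcl : closure (ball c r) = closedBall c r := closure_ball c hr.ne'
    have hfr : frontier (ball c r) = sphere c r := frontier_ball c hr.ne'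
    have hfr0 : volume (frontier (ball c r)) = 0 := by
      rw [hfr]; exact Measure.addHaar_sphere _ _ _
    have hfrΩ : frontier (ball c r) ⊆ Ω := by
      rw [hfr]; exact sphere_subset_closedBall.trans hsub
    have h1 := hdegg (ball c r) isOpen_ball (isConnected_ball hr) (by rwa [hcl]) hfr0
    have h2 := Measure.measure_inter_eq_zero_of_restrict (ae_iff.1 h1)
    refine ⟨({y | ¬ deg g (ball c r) y ≠ 0} ∩ g '' ball c r) ∪ g '' frontier (ball c r),
      measure_union_null h2 (hgN _ hfrΩ hfr0), fun y hy hyZ => ?_⟩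
    have hy1 : y ∉ g '' frontier (ball c r) := fun h => hyZ (Or.inr h)
    have hy2 : deg g (ball c r) y ≠ 0 := by
      by_contra h
      exact hyZ (Or.inl ⟨by simpa using h, hy⟩)
    have hcomp : IsCompact (g '' frontier (ball c r)) := by
      refine IsCompact.image_of_continuousOn ?_ (hgc.mono hfrΩ)
      rw [hfr]; exact isCompact_sphere c r
    have hne : (g '' frontier (ball c r)).Nonempty := by
      rw [hfr]; exact ((NormedSpace.sphere_nonempty).2 hr.le).image g
    have hpos : 0 < infDist y (g '' frontier (ball c r)) :=
      (hcomp.isClosed.notMem_iff_infDist_pos hne).1 hy1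
    have hsq : 0 < Real.sqrt n := Real.sqrt_pos.2 (by exact_mod_cast hn)
    filter_upwards [Metric.tendstoUniformlyOn_iff.1
      (hunif (closedBall c r) hsub (isCompact_closedBall c r)) _ (div_pos hpos hsq),
      Metric.tendstoUniformlyOn_iff.1
      (hunif (closedBall c r) hsub (isCompact_closedBall c r)) _ hpos] with k hk hk'
    have hst := hdeg_stab g (f k) (ball c r) y isOpen_ball isBounded_ball
      (hgc.mono (by rwa [hcl])) ((hfc k).mono (by rwa [hcl])) hy1 (fun x hx => by
        rw [← dist_eq_norm, dist_comm]
        exact hk x (ball_subset_closedBall hx))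
    refine hdeg_sol (f k) (ball c r) y isOpen_ball isBounded_ball
      ((hfc k).mono (by rwa [hcl])) ?_ (by rwa [hst])
    rintro ⟨x, hx, rfl⟩
    have h3 := infDist_le_dist_of_mem (x := f k x) (mem_image_of_mem g hx)
    have h4 := hk' x (by rw [hfr] at hx; exact sphere_subset_closedBall hx)
    rw [dist_comm] at h4
    linarith
  have hex : ∀ x ∈ V, ∃ s > 0, closedBall x s ⊆ V := fun x hx =>
    Metric.nhds_basis_closedBall.mem_iff.1 (hV.mem_nhds hx)
  choose! s hs hsV using hex
  obtain ⟨t, htV, htc, ht⟩ := TopologicalSpace.countable_cover_nhdsWithin (s := V)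
    (f := fun x => ball x (s x)) fun x hx => mem_nhdsWithin_of_mem_nhds (ball_mem_nhds x (hs x hx))
  have key' : ∀ x ∈ V, ∃ Z : Set (Em n), volume Z = 0 ∧
      ∀ y ∈ g '' ball x (s x), y ∉ Z → ∀ᶠ k in atTop, y ∈ f k '' ball x (s x) := fun x hx =>
    key x (s x) (hs x hx) ((hsV x hx).trans hVΩ)
  choose! Z hZ0 hZ using key'
  set B : ℕ → Set (Em n) := fun N => ⋂ k ≥ N, f k '' V with hB
  have hZU : volume (⋃ x ∈ t, Z x) = 0 :=
    (measure_biUnion_null_iff htc).2 fun x hx => hZ0 x (htV hx)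
  have hsub : g '' V ⊆ (⋃ x ∈ t, Z x) ∪ ⋃ N, B N := by
    rintro _ ⟨v, hv, rfl⟩
    obtain ⟨x, hx, hvx⟩ := mem_iUnion₂.1 (ht hv)
    by_cases hz : g v ∈ Z x
    · exact Or.inl (mem_iUnion₂.2 ⟨x, hx, hz⟩)
    · obtain ⟨N, hN⟩ := eventually_atTop.1
        (hZ x (htV hx) (g v) (mem_image_of_mem g hvx) hz)
      refine Or.inr (mem_iUnion.2 ⟨N, mem_iInter₂.2 fun k hk => ?_⟩)
      exact image_mono (ball_subset_closedBall.trans (hsV x (htV hx))) (hN k hk)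
  have hmono : Monotone B := fun a b hab => by
    intro y hy
    exact mem_iInter₂.2 fun k hk => mem_iInter₂.1 hy k (hab.trans hk)
  calc volume (g '' V) ≤ volume (⋃ x ∈ t, Z x) + volume (⋃ N, B N) :=
        (measure_mono hsub).trans (measure_union_le _ _)
    _ = ⨆ N, volume (B N) := by rw [hZU, zero_add, hmono.directed_le.measure_iUnion]
    _ ≤ liminf (fun k => volume (f k '' V)) atTop := by
        refine iSup_le fun N => le_liminf_of_le (by isBoundedDefault) ?_
        filter_upwards [eventually_ge_atTop N] with k hk
        exact measure_mono fun y hy => mem_iInter₂.1 hy k hk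

theorem stmt14 {n : ℕ} (Ω : Set (Em n)) (hΩo : IsOpen Ω) (hΩc : IsConnected Ω)
    (hΩb : Bornology.IsBounded Ω)
    (deg : (Em n → Em n) → Set (Em n) → Em n → ℤ)
    (hdeg_sol : ∀ (h : Em n → Em n) (U : Set (Em n)) (y : Em n),
      IsOpen U → Bornology.IsBounded U → ContinuousOn h (closure U) →
      y ∉ h '' frontier U → deg h U y ≠ 0 → y ∈ h '' U)
    (hdeg_stab : ∀ (h₁ h₂ : Em n → Em n) (U : Set (Em n)) (y : Em n),
      IsOpen U → Bornology.IsBounded U →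
      ContinuousOn h₁ (closure U) → ContinuousOn h₂ (closure U) →
      y ∉ h₁ '' frontier U →
      (∀ x ∈ U, ‖h₂ x - h₁ x‖ < Metric.infDist y (h₁ '' frontier U) / Real.sqrt n) →
      deg h₂ U y = deg h₁ U y)
    (f : ℕ → Em n → Em n) (Df : ℕ → Em n → Em n →L[ℝ] Em n)
    (g : Em n → Em n) (Dg : Em n → Em n →L[ℝ] Em n)
    (hfc : ∀ k, ContinuousOn (f k) Ω)
    (hunif : TendstoLocallyUniformlyOn f g atTop Ω)
    (hfN : ∀ k, LusinN (f k) Ω) (hgN : LusinN g Ω)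
    (hfd : ∀ k, ∀ᵐ x ∂(volume.restrict Ω), HasApproxDerivAt (f k) (Df k x) x)
    (hgd : ∀ᵐ x ∂(volume.restrict Ω), HasApproxDerivAt g (Dg x) x)
    (hUI : ∀ ε : ℝ≥0∞, 0 < ε → ∀ A ⊆ Ω, IsCompact A → ∃ η : ℝ≥0∞, 0 < η ∧
      ∀ E ⊆ A, MeasurableSet E → volume E < η →
        ∀ k, ∫⁻ x in E, ENNReal.ofReal |(Df k x).det| ≤ ε)
    (hdegg : ∀ U : Set (Em n), IsOpen U → IsConnected U → closure U ⊆ Ω →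
      volume (frontier U) = 0 →
      ∀ᵐ y ∂(volume.restrict (g '' U)), deg g U y ≠ 0) :
    ∀ E : Set (Em n), MeasurableSet E → closure E ⊆ Ω →
      Tendsto (fun k => volume (f k '' E)) atTop (𝓝 (volume (g '' E))) := by
  rcases Nat.eq_zero_or_pos n with hn | hn
  · subst hn
    intro E _ _
    have : ∀ k, f k = g := fun k => Subsingleton.elim _ _
    simp [this]
  have hgc : ContinuousOn g Ω := hunif.continuousOn (Frequently.of_forall hfc)
  have hunif' := (tendstoLocallyUniformlyOn_iff_forall_isCompact hΩo).1 hunif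
  have hlow : ∀ V ⊆ Ω, IsOpen V →
      volume (g '' V) ≤ liminf (fun k => volume (f k '' V)) atTop := fun V hVΩ hV =>
    aux_lower hn Ω deg hdeg_sol hdeg_stab f g hfc hgc hunif' hgN hdegg V hVΩ hV
  have hup : ∀ K ⊆ Ω, IsCompact K →
      limsup (fun k => volume (f k '' K)) atTop ≤ volume (g '' K) := fun K hKΩ hK =>
    aux_upper f g K hK (hgc.mono hKΩ) (hunif' K hKΩ hK)
  have harea := fun k => area_le Ω hΩo (f k) (Df k) (hfc k) (hfN k) (hfd k)
  intro E hE hEΩ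
  have hEb : Bornology.IsBounded E := hΩb.subset (subset_closure.trans hEΩ)
  have hEc : IsCompact (closure E) := hEb.isCompact_closure
  have hEf : volume E ≠ ∞ := hEb.measure_lt_top.ne
  obtain ⟨W, hWo, hEW, hWΩ, hWc⟩ := exists_open_between_and_isCompact_closure hEc hΩo hEΩ
  refine tendsto_of_le_liminf_of_limsup_le ?_ ?_
  · refine ENNReal.le_of_forall_pos_le_add fun ε hε _ => ?_
    have hε' : (0 : ℝ≥0∞) < ε := by exact_mod_cast hε
    obtain ⟨η, hη, hηE⟩ := hUI ε hε' (closure W) hWΩ hWc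
    obtain ⟨U, hEU, hUo, -, hU⟩ := hE.exists_isOpen_sdiff_lt hEf hη.ne'
    set V := U ∩ W with hV
    have hVo : IsOpen V := hUo.inter hWo
    have hEV : E ⊆ V := subset_inter hEU (subset_closure.trans hEW)
    have hVW : V ⊆ closure W := inter_subset_right.trans subset_closure
    have hdiff : ∀ k, volume (f k '' (V \ E)) ≤ ε := fun k =>
      (harea k _ (sdiff_subset.trans (hVW.trans hWΩ)) (hVo.measurableSet.diff hE)).trans
        (hηE _ (sdiff_subset.trans hVW) (hVo.measurableSet.diff hE)
          ((measure_mono (sdiff_subset_sdiff_left inter_subset_left)).trans_lt hU) k)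
    have hk : ∀ k, volume (f k '' V) ≤ volume (f k '' E) + ε := fun k => by
      have : f k '' V = f k '' E ∪ f k '' (V \ E) := by
        rw [← image_union, union_sdiff_cancel hEV]
      rw [this]
      exact (measure_union_le _ _).trans (by gcongr; exact hdiff k)
    calc volume (g '' E) ≤ volume (g '' V) := measure_mono (image_mono hEV)
      _ ≤ liminf (fun k => volume (f k '' V)) atTop := hlow V (hVW.trans hWΩ) hVo
      _ ≤ liminf (fun k => volume (f k '' E) + ε) atTop :=
          liminf_le_liminf (Eventually.of_forall hk)
      _ = liminf (fun k => volume (f k '' E)) atTop + ε := by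
          exact liminf_add_const atTop _ _ (by isBoundedDefault) (by isBoundedDefault)
  · refine ENNReal.le_of_forall_pos_le_add fun ε hε _ => ?_
    have hε' : (0 : ℝ≥0∞) < ε := by exact_mod_cast hε
    obtain ⟨η, hη, hηE⟩ := hUI ε hε' (closure E) hEΩ hEc
    obtain ⟨K, hKE, hKc, hK⟩ := hE.exists_isCompact_sdiff_lt hEf hη.ne'
    have hm : MeasurableSet (E \ K) := hE.diff hKc.measurableSet
    have hdiff : ∀ k, volume (f k '' (E \ K)) ≤ ε := fun k =>
      (harea k _ (sdiff_subset.trans (subset_closure.trans hEΩ)) hm).trans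
        (hηE _ (sdiff_subset.trans subset_closure) hm hK k)
    have hk : ∀ k, volume (f k '' E) ≤ volume (f k '' K) + ε := fun k => by
      have : f k '' E = f k '' K ∪ f k '' (E \ K) := by
        rw [← image_union, union_sdiff_cancel hKE]
      rw [this]
      exact (measure_union_le _ _).trans (by gcongr; exact hdiff k)
    calc limsup (fun k => volume (f k '' E)) atTop
        ≤ limsup (fun k => volume (f k '' K) + ε) atTop :=
          limsup_le_limsup (Eventually.of_forall hk)
      _ = limsup (fun k => volume (f k '' K)) atTop + ε := by
          exact limsup_add_const atTop _ _ (by isBoundedDefault) (by isBoundedDefault)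
      _ ≤ volume (g '' E) + ε := by
          gcongr
          exact (hup K (hKE.trans (subset_closure.trans hEΩ)) hKc).trans
            (measure_mono (image_mono hKE))
end
end
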